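/- Let A be a commutative noetherian ring of finite Krull dimension. Then every A-module M admits a Gorenstein projective precover: there exist a Gorenstein projective A-module G and a homomorphism φ : G → M such that every homomorphism G' → M from a Gorenstein projective A-module G' factors through φ. -/

import Mathlib

universe u

/-- A cochain complex `(X, d)` of projective `A`-modules is *totally acyclic* if it is acyclic
and `Hom_A(X, Q)` is acyclic for every projective `A`-module `Q`. -/
def IsTotallyAcyclic (A : Type u) [CommRing A] (X : ℤ → Type u)
    [∀ n, AddCommGroup (X n)] [∀ n, Module A (X n)]
    (d : ∀ n, X n →ₗ[A] X (n + 1)) : Prop :=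
  (∀ n, Function.Exact (d n) (d (n + 1))) ∧
  ∀ (Q : Type u) [AddCommGroup Q] [Module A Q], Module.Projective A Q →
    ∀ n, Function.Exact (LinearMap.lcomp A Q (d (n + 1))) (LinearMap.lcomp A Q (d n))

/-- An `A`-module is Gorenstein projective if it is isomorphic to a syzygy
`Z^n(P) = ker (Pⁿ → Pⁿ⁺¹)` of a totally acyclic complex `P` of projective modules. -/
def IsGorensteinProjective (A : Type u) [CommRing A] (G : Type u) [AddCommGroup G]
    [Module A G] : Prop :=
  ∃ (X : ℤ → Type u) (_ : ∀ n, AddCommGroup (X n)) (_ : ∀ n, Module A (X n))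
    (d : ∀ n, X n →ₗ[A] X (n + 1)),
    (∀ n, Module.Projective A (X n)) ∧ IsTotallyAcyclic A X d ∧
    ∃ n : ℤ, Nonempty (G ≃ₗ[A] ↥(LinearMap.ker (d n)))

open Cardinal in
theorem gp_mk_finsupp_le (J R : Type u) [Infinite J] [CommRing R] (ν : Cardinal.{u})
    (hJ : #J ≤ ν) (hR : #R ≤ ν) : #(J →₀ R) ≤ ν := by
  have hν : ℵ₀ ≤ ν := (aleph0_le_mk J).trans hJ
  rcases subsingleton_or_nontrivial R with h | h
  · have : Subsingleton (J →₀ R) := inferInstance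
    exact (le_one_iff_subsingleton.2 this).trans (one_lt_aleph0.le.trans hν)
  · rw [mk_finsupp_lift_of_infinite]
    simp [hJ, hR]

open Cardinal in
/-- closing lemma -/
theorem gp_closing {R : Type u} [CommRing R] {M : Type u} [AddCommGroup M] [Module R M]
    {N : Type u} [Nonempty N] (φ : M → N) (J : Type u) [Infinite J] (x : M) (ν : Cardinal.{u})
    (hJ : #J ≤ ν) (hR : #R ≤ ν) (hN : #N ≤ ν) :
    ∃ M' : Submodule R M, x ∈ M' ∧ #M' ≤ 2 ^ ν ∧
      ∀ s : J → M, ∃ t : J → M, (∀ j, t j ∈ M') ∧ (∀ j, s j ∈ M' → t j = s j) ∧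
        (∀ j, φ (t j) = φ (s j)) ∧
        ∀ c : J →₀ R, c.sum (fun j a => a • s j) = 0 → c.sum (fun j a => a • t j) = 0 := by
  classical
  have hν : ℵ₀ ≤ ν := (aleph0_le_mk J).trans hJ
  let α : Type u := Option (Set J × Set (J →₀ R) × (J → N) × J)
  let β : α → Type u := fun a => match a with
    | none => PEmpty.{u + 1}
    | some _ => J
  let Good : Set J → Set (J →₀ R) → (J → N) → (J → M) → (J → M) → Prop :=
    fun mask K n b t => (∀ c ∈ K, c.sum (fun j a => a • t j) = 0) ∧ (∀ j, φ (t j) = n j) ∧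
      ∀ j ∈ mask, t j = b j
  let step : (Σ a : α, β a → M) → M := fun p =>
    match p with
    | ⟨none, _⟩ => x
    | ⟨some (mask, K, n, j), b⟩ => if h : ∃ t, Good mask K n b t then h.choose j else 0
  let ev : WType β → M := WType.elim M step
  have hev : ∀ a f, ev (WType.mk a f) = step ⟨a, fun j => ev (f j)⟩ := fun a f => rfl
  let w0 : WType β := WType.mk none (fun e => PEmpty.elim e)
  have hclose : ∀ s : J → M, ∃ t : J → M, (∀ j, t j ∈ Set.range ev) ∧
      (∀ j, s j ∈ Set.range ev → t j = s j) ∧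
        (∀ j, φ (t j) = φ (s j)) ∧
        ∀ c : J →₀ R, c.sum (fun j a => a • s j) = 0 → c.sum (fun j a => a • t j) = 0 := by
    intro s
    let mask : Set J := {j | s j ∈ Set.range ev}
    let K : Set (J →₀ R) := {c | c.sum (fun j a => a • s j) = 0}
    let f : J → WType β := fun j => if h : s j ∈ Set.range ev then h.choose else w0
    have hf : ∀ j ∈ mask, ev (f j) = s j := by
      intro j hj
      have hj' : s j ∈ Set.range ev := hj
      simp only [f, dif_pos hj']
      exact hj'.choose_spec
    have hex : ∃ t, Good mask K (fun j => φ (s j)) (fun j => ev (f j)) t :=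
      ⟨s, fun c hc => hc, fun _ => rfl, fun j hj => (hf j hj).symm⟩
    refine ⟨hex.choose, fun j => ⟨WType.mk (some (mask, K, (fun j => φ (s j)), j)) f, ?_⟩, ?_,
      hex.choose_spec.2.1, fun c hc => hex.choose_spec.1 c hc⟩
    · rw [hev]
      exact dif_pos hex
    · intro j hj
      exact (hex.choose_spec.2.2 j hj).trans (hf j hj)
  obtain ⟨j0⟩ : Nonempty J := inferInstance
  obtain ⟨j1, hj1⟩ : ∃ j1, j1 ∉ ({j0} : Finset J) := Infinite.exists_notMem_finset _
  obtain ⟨j2, hj2⟩ : ∃ j2, j2 ∉ ({j0, j1} : Finset J) := Infinite.exists_notMem_finset _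
  simp only [Finset.mem_singleton, Finset.mem_insert, not_or] at hj1 hj2
  have hsmul : ∀ (r : R) (m : M), m ∈ Set.range ev → r • m ∈ Set.range ev := by
    intro r m hm
    obtain ⟨t, ht, hts, -, hc⟩ := hclose (fun j => if j = j0 then m else r • m)
    have h0 : t j0 = m := by simpa using hts j0 (by simpa using hm)
    have := hc (Finsupp.single j0 r - Finsupp.single j1 1) (by
      rw [Finsupp.sum_sub_index (by intros; rw [sub_smul])]
      simp [hj1])
    rw [Finsupp.sum_sub_index (by intros; rw [sub_smul])] at this
    simp only [zero_smul, Finsupp.sum_single_index, h0, one_smul, sub_eq_zero] at this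
    rw [this]; exact ht j1
  have hadd : ∀ (m n : M), m ∈ Set.range ev → n ∈ Set.range ev → m + n ∈ Set.range ev := by
    intro m n hm hn
    obtain ⟨t, ht, hts, -, hc⟩ := hclose (fun j => if j = j0 then m else if j = j1 then n else m + n)
    have h0 : t j0 = m := by simpa using hts j0 (by simpa using hm)
    have h1 : t j1 = n := by simpa [hj1] using hts j1 (by simpa [hj1] using hn)
    have := hc (Finsupp.single j0 1 + Finsupp.single j1 1 - Finsupp.single j2 1) (by
      rw [Finsupp.sum_sub_index (by intros; rw [sub_smul]),
        Finsupp.sum_add_index' (by simp) (by intros; rw [add_smul])]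
      simp [hj1, hj2])
    rw [Finsupp.sum_sub_index (by intros; rw [sub_smul]),
        Finsupp.sum_add_index' (by simp) (by intros; rw [add_smul])] at this
    simp only [zero_smul, Finsupp.sum_single_index, h0, h1, one_smul, sub_eq_zero] at this
    rw [this]; exact ht j2
  have hx : x ∈ Set.range ev := ⟨w0, rfl⟩
  refine ⟨{ carrier := Set.range ev, add_mem' := fun ha hb => hadd _ _ ha hb, zero_mem' := ?_,
            smul_mem' := fun c m hm => hsmul c m hm }, hx, ?_, hclose⟩
  · simpa using hsmul 0 x hx
  · change #(Set.range ev) ≤ _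
    refine mk_range_le.trans (WType.cardinalMk_le_of_le ?_)
    have h2ν : ℵ₀ ≤ (2 : Cardinal.{u}) ^ ν := hν.trans (cantor ν).le
    have hpow : ∀ κ : Cardinal.{u}, κ ≤ ν → ((2 : Cardinal.{u}) ^ ν) ^ κ ≤ 2 ^ ν := by
      intro κ hκ
      rw [← power_mul]
      exact power_le_power_left two_ne_zero ((mul_le_mul_right hκ ν).trans (mul_eq_self hν).le)
    have hterm : ∀ a : α, ((2 : Cardinal.{u}) ^ ν) ^ #(β a) ≤ 2 ^ ν := by
      intro a
      apply hpow
      rcases a with _ | a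
      · simp [β]
      · exact hJ
    refine (sum_le_sum _ _ hterm).trans ?_
    rw [sum_const']
    refine (mul_le_mul_left (?_ : #α ≤ 2 ^ ν) _).trans (mul_eq_self h2ν).le
    have hfs : #(J →₀ R) ≤ ν := gp_mk_finsupp_le J R ν hJ hR
    have hN' : #(J → N) ≤ 2 ^ ν := by
      rw [← power_def]
      exact (power_le_power_right (hN.trans (cantor ν).le)).trans (hpow _ hJ)
    have hm : ∀ a b : Cardinal.{u}, a ≤ 2 ^ ν → b ≤ 2 ^ ν → a * b ≤ 2 ^ ν := fun a b ha hb =>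
      (mul_le_mul' ha hb).trans (mul_eq_self h2ν).le
    have : #(Set J × Set (J →₀ R) × (J → N) × J) ≤ 2 ^ ν := by
      simp only [mk_prod, lift_id]
      refine hm _ _ ?_ (hm _ _ ?_ (hm _ _ hN' (hJ.trans (cantor ν).le)))
      · rw [mk_set]; exact power_le_power_left two_ne_zero hJ
      · rw [mk_set]; exact power_le_power_left two_ne_zero hfs
    change #(Option _) ≤ _
    rw [mk_option]
    exact (add_le_add this (one_lt_aleph0.le.trans h2ν)).trans (add_eq_self h2ν).le

/-- purity of submodules by finite systems of equations -/
def GPPure {R : Type u} [CommRing R] {M : Type u} [AddCommGroup M] [Module R M]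
    (H : Submodule R M) : Prop :=
  ∀ (ι κ : Type u) [Fintype ι] [Fintype κ] (r : ι → κ → R) (y : κ → M),
    (∀ i, ∑ j, r i j • y j ∈ H) → ∃ y' : κ → M, (∀ j, y' j ∈ H) ∧
      ∀ i, ∑ j, r i j • y' j = ∑ j, r i j • y j

theorem GPPure.bot {R : Type u} [CommRing R] {M : Type u} [AddCommGroup M] [Module R M] :
    GPPure (⊥ : Submodule R M) := by
  intro ι κ _ _ r y hy
  exact ⟨0, by simp, fun i => by simpa using (hy i).symm⟩

theorem GPPure.comap {R : Type u} [CommRing R] {M : Type u} [AddCommGroup M] [Module R M]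
    {H : Submodule R M} (hH : GPPure H) {H' : Submodule R (M ⧸ H)} (hH' : GPPure H') :
    GPPure (H'.comap H.mkQ) := by
  intro ι κ _ _ r y hy
  obtain ⟨y1, h1, h2⟩ := hH' ι κ r (fun j => H.mkQ (y j)) (fun i => by
    have := hy i
    simpa [Submodule.mem_comap, map_sum] using this)
  choose y2 hy2 using fun j => H.mkQ_surjective (y1 j)
  obtain ⟨y3, h3, h4⟩ := hH ι κ r (fun j => y j - y2 j) (fun i => by
    rw [← Submodule.ker_mkQ H, LinearMap.mem_ker, map_sum]
    simp only [smul_sub, map_sub, map_smul, hy2, Finset.sum_sub_distrib, h2 i, sub_self])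
  refine ⟨fun j => y2 j + y3 j, fun j => ?_, fun i => ?_⟩
  · rw [Submodule.mem_comap, map_add, hy2]
    have : H.mkQ (y3 j) = 0 := by
      rw [← LinearMap.mem_ker, Submodule.ker_mkQ]; exact h3 j
    rw [this, add_zero]; exact h1 j
  · simp only [smul_add, Finset.sum_add_distrib, h4 i, smul_sub, Finset.sum_sub_distrib]
    abel

open Cardinal in
theorem gp_small_pure {R : Type u} [CommRing R] {M : Type u} [AddCommGroup M] [Module R M]
    (x : M) : ∃ S : Submodule R M, x ∈ S ∧ GPPure S ∧ #S ≤ 2 ^ (max #R ℵ₀) := by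
  classical
  let J : Type u := ULift.{u} ℕ
  obtain ⟨S, hx, hS, hc⟩ := gp_closing (R := R) (fun _ : M => PUnit.unit.{u + 1}) J x (max #R ℵ₀)
    (by simp [J]) (le_max_left _ _) (by simp [one_lt_aleph0.le])
  refine ⟨S, hx, ?_, hS⟩
  intro ι κ _ _ r y hy
  obtain ⟨e⟩ : Nonempty (ι ⊕ κ ↪ J) := by
    have : Countable (ι ⊕ κ) := inferInstance
    obtain ⟨f, hf⟩ := exists_injective_nat (ι ⊕ κ)
    exact ⟨⟨fun a => ⟨f a⟩, fun a b h => hf (ULift.up_injective h)⟩⟩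
  let v : ι ⊕ κ → M := Sum.elim (fun i => ∑ j, r i j • y j) y
  obtain ⟨t, ht, hts, -, hrel⟩ := hc (Function.extend e v 0)
  refine ⟨fun j => t (e (Sum.inr j)), fun j => ht _, fun i => ?_⟩
  have hti : t (e (Sum.inl i)) = ∑ j, r i j • y j := by
    rw [hts]
    · rw [e.injective.extend_apply]; rfl
    · rw [e.injective.extend_apply]; exact hy i
  have key : ∀ s : J → M, ((∑ j, Finsupp.single (e (Sum.inr j)) (r i j)) -
      Finsupp.single (e (Sum.inl i)) 1 : J →₀ R).sum (fun j a => a • s j) =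
      (∑ j, r i j • s (e (Sum.inr j))) - s (e (Sum.inl i)) := by
    intro s
    rw [Finsupp.sum_sub_index (by intros; rw [sub_smul]),
      ← Finsupp.sum_finsetSum_index (by simp) (by intros; rw [add_smul])]
    simp
  have := hrel _ (by
    rw [key]
    simp only [e.injective.extend_apply]
    simp [v])
  rw [key, hti, sub_eq_zero] at this
  exact this

open Cardinal in
theorem gp_bbe_step {R : Type u} [CommRing R] {M : Type u} [AddCommGroup M] [Module R M]
    {N : Type u} [AddCommGroup N] (φ : M →+ N)
    (hM : ∀ H : Submodule R M, GPPure H → (∀ m ∈ H, φ m = 0) → H = ⊥) :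
    #M ≤ 2 ^ max (2 ^ (max #R ℵ₀)) #N := by
  classical
  set μ : Cardinal.{u} := 2 ^ (max #R ℵ₀) with hμ
  have hμ0 : ℵ₀ ≤ μ := (le_max_right _ _).trans (cantor _).le
  have hμR : #R ≤ μ := (le_max_left _ _).trans (cantor _).le
  let J : Type u := μ.out
  have hJ : #J = μ := mk_out μ
  have : Infinite J := by rw [infinite_iff, hJ]; exact hμ0
  obtain ⟨M', -, hcard, hclose⟩ := gp_closing (R := R) φ J 0 (max μ #N) (by rw [hJ]; exact le_max_left _ _)
    (hμR.trans (le_max_left _ _)) (le_max_right _ _)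
  by_cases htop : M' = ⊤
  · rw [htop] at hcard
    exact (mk_le_of_injective (f := fun m : M => (⟨m, trivial⟩ : (⊤ : Submodule R M)))
      (fun a b h => congrArg Subtype.val h)).trans hcard
  exfalso
  obtain ⟨x, hx⟩ : ∃ x, x ∉ M' := by
    by_contra h; push Not at h; exact htop (eq_top_iff.2 fun a _ => h a)
  obtain ⟨Sb, hxS, hpure, hSb⟩ := gp_small_pure (R := R) (M'.mkQ x)
  choose l hl using fun z : Sb => M'.mkQ_surjective (z : M ⧸ M')
  let S : Submodule R M := Submodule.span R (Set.range l)
  have hSle : ∀ m ∈ S, M'.mkQ m ∈ Sb := by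
    have : S ≤ Sb.comap M'.mkQ := Submodule.span_le.2 (by
      rintro _ ⟨z, rfl⟩
      simp only [SetLike.mem_coe, Submodule.mem_comap, hl]; exact z.2)
    exact this
  have hScard : #S ≤ #J := by
    rw [hJ]
    obtain ⟨g, hg⟩ : ∃ g : J → Sb, Function.Surjective g := by
      have h0 : #Sb ≤ #J := by rw [hJ]; exact hSb
      obtain ⟨g⟩ := h0
      exact ⟨Function.invFun g, Function.invFun_surjective g.injective⟩
    have h1 : S = LinearMap.range (Finsupp.linearCombination R (l ∘ g)) := by
      rw [Finsupp.range_linearCombination, hg.range_comp]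
    rw [h1]
    have h2 : #(LinearMap.range (Finsupp.linearCombination R (l ∘ g))) ≤ #(J →₀ R) :=
      mk_le_of_surjective (LinearMap.surjective_rangeRestrict _)
    exact h2.trans (gp_mk_finsupp_le J R μ hJ.le hμR)
  obtain ⟨e, he⟩ : ∃ e : J → S, Function.Surjective e := by
    obtain ⟨g⟩ := hScard
    exact ⟨Function.invFun g, Function.invFun_surjective g.injective⟩
  let s : J → M := fun j => e j
  obtain ⟨t, ht, hts, hφ, hrel⟩ := hclose s
  have hs : ∀ m ∈ S, ∃ j, s j = m := fun m hm => by
    obtain ⟨j, hj⟩ := he ⟨m, hm⟩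
    exact ⟨j, by simp [s, hj]⟩
  have hsS : ∀ j, s j ∈ S := fun j => (e j).2
  have hrel' : ∀ (κ : Type u) [Fintype κ] (a : κ → R) (k : κ → J), ∑ i, a i • s (k i) = 0 →
      ∑ i, a i • t (k i) = 0 := by
    intro κ _ a k h
    have key : ∀ s : J → M, (∑ i, Finsupp.single (k i) (a i) : J →₀ R).sum (fun j a => a • s j) =
      ∑ i, a i • s (k i) := by
      intro s
      rw [← Finsupp.sum_finsetSum_index (by simp) (by intros; rw [add_smul])]
      simp
    have := hrel _ ((key s).trans h)
    rwa [key] at this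
  have hrel2 : ∀ (κ : Type u) [Fintype κ] (a : κ → R) (k : κ → J) (l : J), ∑ i, a i • s (k i) = s l →
      ∑ i, a i • t (k i) = t l := by
    intro κ _ a k l h
    have := hrel' (Option κ) (fun o => o.elim (-1) a) (fun o => o.elim l k) (by
      simp [Fintype.sum_option, h])
    simp only [Fintype.sum_option, Option.elim_none, Option.elim_some, neg_smul, one_smul] at this
    exact (neg_add_eq_zero.1 this).symm
  let H : Submodule R M :=
    { carrier := {m | ∃ j, m = s j - t j}
      add_mem' := by
        rintro _ _ ⟨j, rfl⟩ ⟨k, rfl⟩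
        obtain ⟨l, hl⟩ := hs (s j + s k) (add_mem (hsS j) (hsS k))
        have := hrel2 (Option PUnit) (fun _ => 1) (fun b => b.elim j (fun _ => k)) l (by
          simp [Fintype.sum_option, hl])
        simp [Fintype.sum_option] at this
        exact ⟨l, by rw [hl, ← this]; abel⟩
      zero_mem' := by
        obtain ⟨l, hl⟩ := hs 0 (zero_mem _)
        have := hrel2 (PEmpty) (fun _ => 1) (fun b => b.elim) l (by simp [hl])
        refine ⟨l, ?_⟩
        simp at this
        simp [hl, ← this]
      smul_mem' := by
        rintro r _ ⟨j, rfl⟩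
        obtain ⟨l, hl⟩ := hs (r • s j) (S.smul_mem r (hsS j))
        have := hrel2 (PUnit) (fun _ => r) (fun b => j) l (by simp [hl])
        simp at this
        exact ⟨l, by rw [hl, ← this, smul_sub]⟩ }
  have hH : GPPure H := by
    intro ι κ _ _ r y hy
    choose k hk using hy
    have hq : ∀ i, ∑ j, r i j • M'.mkQ (y j) = M'.mkQ (s (k i)) := by
      intro i
      have h0 : M'.mkQ (t (k i)) = 0 := by
        rw [← LinearMap.mem_ker, Submodule.ker_mkQ]; exact ht _
      have := congrArg M'.mkQ (hk i)
      simpa only [map_sum, map_smul, map_sub, h0, sub_zero] using this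
    obtain ⟨y1, hy1, hy1'⟩ := hpure ι κ r (fun j => M'.mkQ (y j)) (fun i => by
      rw [hq i]; exact hSle _ (hsS _))
    choose n hn using fun j => hs (l ⟨y1 j, hy1 j⟩) (Submodule.subset_span ⟨_, rfl⟩)
    have hn' : ∀ j, M'.mkQ (s (n j)) = y1 j := fun j => by rw [hn, hl]
    refine ⟨fun j => s (n j) - t (n j), fun j => ⟨n j, rfl⟩, fun i => ?_⟩
    obtain ⟨z, hz⟩ := hs (∑ j, r i j • s (n j) - s (k i))
      (sub_mem (Submodule.sum_mem _ fun j _ => S.smul_mem _ (hsS _)) (hsS _))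
    have hzM : s z ∈ M' := by
      rw [hz, ← Submodule.ker_mkQ M', LinearMap.mem_ker, map_sub, map_sum]
      simp only [map_smul, hn', hy1', hq, sub_self]
    have h1 := hrel2 (Option κ) (fun o => o.elim (-1) (r i)) (fun o => o.elim (k i) n) z (by
      simp only [Fintype.sum_option, Option.elim_none, Option.elim_some, neg_smul, one_smul, hz]
      abel)
    simp only [Fintype.sum_option, Option.elim_none, Option.elim_some, neg_smul, one_smul,
      hts z hzM, hz] at h1
    rw [hk i]
    simp only [smul_sub, Finset.sum_sub_distrib]
    have h2 : ∑ j, r i j • t (n j) = ∑ j, r i j • s (n j) - s (k i) + t (k i) := by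
      rw [← h1]; abel
    rw [h2]; abel
  have hbot := hM H hH (by
    rintro _ ⟨j, rfl⟩
    rw [map_sub, hφ, sub_self])
  obtain ⟨j, hj⟩ := hs (l ⟨_, hxS⟩) (Submodule.subset_span ⟨_, rfl⟩)
  have hmem : s j - t j ∈ H := ⟨j, rfl⟩
  rw [hbot, Submodule.mem_bot, sub_eq_zero] at hmem
  have hq : M'.mkQ (s j) = M'.mkQ x := by rw [hj, hl]
  have : M'.mkQ (s j) = 0 := by
    rw [hmem, ← LinearMap.mem_ker, Submodule.ker_mkQ]; exact ht _
  rw [this] at hq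
  apply hx
  rw [← Submodule.ker_mkQ M', LinearMap.mem_ker, ← hq]

open Cardinal in
theorem gp_bbe {R : Type u} [CommRing R] {M : Type u} [AddCommGroup M] [Module R M]
    {N : Type u} [AddCommGroup N] (φ : M →+ N) :
    ∃ H : Submodule R M, GPPure H ∧ (∀ m ∈ H, φ m = 0) ∧
      #(M ⧸ H) ≤ 2 ^ max (2 ^ (max #R ℵ₀)) #N := by
  classical
  obtain ⟨H, hH⟩ : ∃ H : Submodule R M, Maximal (fun H => GPPure H ∧ ∀ m ∈ H, φ m = 0) H := by
    refine zorn_le₀ {H : Submodule R M | GPPure H ∧ ∀ m ∈ H, φ m = 0} ?_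
    intro c hc hchain
    rcases c.eq_empty_or_nonempty with rfl | hne
    · exact ⟨⊥, ⟨GPPure.bot, by simp⟩, by simp⟩
    have hmem : ∀ x, x ∈ sSup c ↔ ∃ y ∈ c, x ∈ y := fun x =>
      Submodule.mem_sSup_of_directed hne hchain.directedOn
    refine ⟨sSup c, ⟨?_, ?_⟩, fun H hH => le_sSup hH⟩
    · intro ι κ _ _ r y hy
      choose Hi hHi hyi using fun i => (hmem _).1 (hy i)
      obtain ⟨K, hK, hKi⟩ : ∃ K ∈ c, ∀ i, Hi i ≤ K := by
        have : ∀ s : Finset ι, ∃ K ∈ c, ∀ i ∈ s, Hi i ≤ K := by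
          intro s
          induction s using Finset.induction_on with
          | empty => obtain ⟨K, hK⟩ := hne; exact ⟨K, hK, by simp⟩
          | insert a s _ ih =>
            obtain ⟨K, hK, hs⟩ := ih
            rcases hchain.total hK (hHi a) with h | h
            · refine ⟨Hi a, hHi a, fun i hi => ?_⟩
              rcases Finset.mem_insert.1 hi with rfl | hi
              · exact le_rfl
              · exact (hs i hi).trans h
            · refine ⟨K, hK, fun i hi => ?_⟩
              rcases Finset.mem_insert.1 hi with rfl | hi
              · exact h
              · exact hs i hi
        obtain ⟨K, hK, h⟩ := this Finset.univ
        exact ⟨K, hK, fun i => h i (Finset.mem_univ i)⟩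
      obtain ⟨y', h1, h2⟩ := (hc hK).1 ι κ r y (fun i => hKi i (hyi i))
      exact ⟨y', fun j => (hmem _).2 ⟨K, hK, h1 j⟩, h2⟩
    · intro m hm
      obtain ⟨K, hK, hmK⟩ := (hmem m).1 hm
      exact (hc hK).2 m hmK
  refine ⟨H, hH.prop.1, hH.prop.2, ?_⟩
  let φ' : (M ⧸ H) →+ N := QuotientAddGroup.lift H.toAddSubgroup φ (fun m hm => hH.prop.2 m hm)
  have hφ' : ∀ m, φ' (H.mkQ m) = φ m := fun m => rfl
  refine gp_bbe_step φ' (fun H' hp hk => ?_)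
  have hle : H'.comap H.mkQ ≤ H := hH.le_of_ge ⟨hH.prop.1.comap hp, fun m hm => by
    rw [← hφ']; exact hk _ hm⟩ (fun m hm => by
      have : H.mkQ m = 0 := by rw [← LinearMap.mem_ker, Submodule.ker_mkQ]; exact hm
      rw [Submodule.mem_comap, this]; exact zero_mem _)
  rw [eq_bot_iff]
  intro z hz
  obtain ⟨m, rfl⟩ := H.mkQ_surjective z
  have : m ∈ H := hle hz
  rw [Submodule.mem_bot, ← LinearMap.mem_ker, Submodule.ker_mkQ]
  exact this

theorem gp_embed (A : Type u) [CommRing A] (X : Type u) [AddCommGroup X] [Module A X] :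
    ∃ (I : Type u) (_ : AddCommGroup I) (_ : Module A I) (i : X →ₗ[A] I),
      Module.Injective A I ∧ Function.Injective i := by
  let J := CategoryTheory.Injective.under (ModuleCat.of A X)
  refine ⟨J, inferInstance, inferInstance,
    (CategoryTheory.Injective.ι (ModuleCat.of A X)).hom, ?_, ?_⟩
  · exact (Module.injective_iff_injective_object A J).2
      (CategoryTheory.Injective.injective_under (ModuleCat.of A X))
  · exact (ModuleCat.mono_iff_injective _).1 inferInstance

section
variable {A : Type u} [CommRing A]

theorem gp_inj_factor {X Z I : Type u} [AddCommGroup X] [Module A X] [AddCommGroup Z]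
    [Module A Z] [AddCommGroup I] [Module A I] (hI : Module.Injective A I)
    (L : X →ₗ[A] Z) (Y : X →ₗ[A] I) (h : LinearMap.ker L ≤ LinearMap.ker Y) :
    ∃ g : Z →ₗ[A] I, g ∘ₗ L = Y := by
  obtain ⟨g, hg⟩ := hI.out ((LinearMap.ker L).liftQ L le_rfl)
    (LinearMap.ker_eq_bot.1 (Submodule.ker_liftQ_eq_bot _ _ _ le_rfl))
    ((LinearMap.ker L).liftQ Y h)
  refine ⟨g, LinearMap.ext fun x => ?_⟩
  simpa using hg (Submodule.Quotient.mk x)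

/-- linear combination map -/
theorem gp_inj_exact {I : Type u} [AddCommGroup I] [Module A I] (hI : Module.Injective A I)
    {l m : ℕ} (a : Fin l → A) (b : Fin m → Fin l → A)
    (hb : ∀ c : Fin l → A, ∑ i, c i * a i = 0 → c ∈ Submodule.span A (Set.range b))
    (y : Fin l → I) (hy : ∀ j, ∑ i, b j i • y i = 0) : ∃ x : I, ∀ i, y i = a i • x := by
  obtain ⟨g, hg⟩ := gp_inj_factor hI (Fintype.linearCombination A a)
    (Fintype.linearCombination A y) (by
      intro c hc
      have hc' := hb c (by simpa [Fintype.linearCombination_apply] using hc)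
      refine (Submodule.span_le.2 ?_) hc'
      rintro _ ⟨j, rfl⟩
      simpa [Fintype.linearCombination_apply] using hy j)
  refine ⟨g 1, fun i => ?_⟩
  have := LinearMap.congr_fun hg (Pi.single i 1)
  simp only [LinearMap.comp_apply, Fintype.linearCombination_apply_single, one_smul] at this
  rw [← this, ← map_smul, smul_eq_mul, mul_one]

theorem gp_hom_solve {I J : Type u} [AddCommGroup I] [Module A I] (hI : Module.Injective A I)
    [AddCommGroup J] [Module A J] (hJ : Module.Injective A J)
    {l m : ℕ} (a : Fin l → A) (b : Fin m → Fin l → A)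
    (hb : ∀ c : Fin l → A, ∑ i, c i * a i = 0 → c ∈ Submodule.span A (Set.range b))
    (f : Fin l → I →ₗ[A] J) (hf : ∑ i, a i • f i = 0) :
    ∃ g : Fin m → I →ₗ[A] J, ∀ i, f i = ∑ j, b j i • g j := by
  let Λ : (Fin l → I) →ₗ[A] (Fin m → I) :=
    LinearMap.pi fun j => ∑ i, b j i • LinearMap.proj i
  let Θ : (Fin l → I) →ₗ[A] J := ∑ i, f i ∘ₗ LinearMap.proj i
  obtain ⟨h, hh⟩ := gp_inj_factor hJ Λ Θ (by
    intro y hy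
    obtain ⟨x, hx⟩ := gp_inj_exact hI a b hb y (fun j => by
      have := congrFun (LinearMap.mem_ker.1 hy) j
      simpa [Λ] using this)
    have := LinearMap.congr_fun hf x
    simpa [Θ, hx] using this)
  refine ⟨fun j => h ∘ₗ LinearMap.single A (fun _ => I) j, fun i => LinearMap.ext fun y => ?_⟩
  have h1 := LinearMap.congr_fun hh (Pi.single i y)
  have h2 : Θ (Pi.single i y) = f i y := by
    simp only [Θ, LinearMap.sum_apply, LinearMap.comp_apply, LinearMap.proj_apply]
    rw [Finset.sum_eq_single i]
    · simp
    · intro k _ hk; simp [hk]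
    · simp
  have h3 : Λ (Pi.single i y) = ∑ j, b j i • Pi.single j y := by
    ext j
    simp only [Λ, LinearMap.pi_apply, LinearMap.sum_apply, LinearMap.smul_apply,
      LinearMap.proj_apply, Finset.sum_apply, Pi.smul_apply]
    rw [Finset.sum_eq_single i, Finset.sum_eq_single j]
    · simp
    · intro k _ hk; simp [Ne.symm hk]
    · simp
    · intro k _ hk; simp [hk]
    · simp
  rw [← h2, ← h1, LinearMap.comp_apply, h3]
  simp

theorem gp_rel_gens [IsNoetherianRing A] {l : ℕ} (a : Fin l → A) :
    ∃ (m : ℕ) (b : Fin m → Fin l → A), (∀ j, ∑ i, b j i * a i = 0) ∧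
      ∀ c : Fin l → A, ∑ i, c i * a i = 0 → c ∈ Submodule.span A (Set.range b) := by
  obtain ⟨m, b, hb⟩ := Submodule.fg_iff_exists_fin_generating_family.1
    (IsNoetherian.noetherian (LinearMap.ker (Fintype.linearCombination A a)))
  refine ⟨m, b, fun j => ?_, fun c hc => ?_⟩
  · have : b j ∈ LinearMap.ker (Fintype.linearCombination A a) := by
      rw [← hb]; exact Submodule.subset_span ⟨j, rfl⟩
    simpa [Fintype.linearCombination_apply] using this
  · rw [hb]; simpa [Fintype.linearCombination_apply] using hc

theorem gp_pi_hom_flat [IsNoetherianRing A] {ι : Type u} (I J : ι → Type u)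
    [∀ q, AddCommGroup (I q)] [∀ q, Module A (I q)] [∀ q, AddCommGroup (J q)]
    [∀ q, Module A (J q)] (hI : ∀ q, Module.Injective A (I q))
    (hJ : ∀ q, Module.Injective A (J q)) : Module.Flat A (∀ q, I q →ₗ[A] J q) := by
  refine Module.Flat.of_forall_isTrivialRelation fun {l a x} h => ?_
  obtain ⟨m, b, hb0, hb⟩ := gp_rel_gens a
  have : ∀ q, ∃ g : Fin m → I q →ₗ[A] J q, ∀ i, x i q = ∑ j, b j i • g j := fun q =>
    gp_hom_solve (hI q) (hJ q) a b hb (fun i => x i q) (by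
      have := congrFun h q
      simpa using this)
  choose g hg using this
  refine ⟨m, fun i j => b j i, fun j q => g q j, fun i => ?_, fun j => ?_⟩
  · funext q; rw [hg]; simp
  · rw [← hb0 j]; exact Finset.sum_congr rfl fun i _ => mul_comm _ _

theorem gp_hom_flat [IsNoetherianRing A] (I J : Type u)
    [AddCommGroup I] [Module A I] [AddCommGroup J]
    [Module A J] (hI : Module.Injective A I)
    (hJ : Module.Injective A J) : Module.Flat A (I →ₗ[A] J) := by
  refine Module.Flat.of_forall_isTrivialRelation fun {l a x} h => ?_
  obtain ⟨m, b, hb0, hb⟩ := gp_rel_gens a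
  obtain ⟨g, hg⟩ := gp_hom_solve hI hJ a b hb x h
  refine ⟨m, fun i j => b j i, fun j => g j, fun i => hg i, fun j => ?_⟩
  rw [← hb0 j]; exact Finset.sum_congr rfl fun i _ => mul_comm _ _

/-- relatively injective -/
def GPRelinj (A : Type u) [CommRing A] (C : Type u) [AddCommGroup C] [Module A C] : Prop :=
  ∀ (K P : Type u) [AddCommGroup K] [Module A K] [AddCommGroup P] [Module A P] (i : K →ₗ[A] P),
    (∀ (I : Type u) [AddCommGroup I] [Module A I], Module.Injective A I →
      Function.Injective (i.rTensor I)) →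
    ∀ f : K →ₗ[A] C, ∃ g : P →ₗ[A] C, g ∘ₗ i = f

theorem gp_pi_hom_relinj {ι : Type u} (I J : ι → Type u)
    [∀ q, AddCommGroup (I q)] [∀ q, Module A (I q)] [∀ q, AddCommGroup (J q)]
    [∀ q, Module A (J q)] (hI : ∀ q, Module.Injective A (I q))
    (hJ : ∀ q, Module.Injective A (J q)) : GPRelinj A (∀ q, I q →ₗ[A] J q) := by
  intro K P _ _ _ _ i hi f
  have : ∀ q, ∃ g : P →ₗ[A] (I q →ₗ[A] J q), g ∘ₗ i = LinearMap.proj q ∘ₗ f := by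
    intro q
    obtain ⟨g, hg⟩ := (hJ q).out (i.rTensor (I q)) (hi _ (hI q))
      (TensorProduct.lift (LinearMap.proj q ∘ₗ f))
    refine ⟨TensorProduct.curry g, LinearMap.ext fun k => LinearMap.ext fun x => ?_⟩
    simpa using hg (k ⊗ₜ x)
  choose g hg using this
  refine ⟨LinearMap.pi g, LinearMap.ext fun k => funext fun q => ?_⟩
  exact LinearMap.congr_fun (hg q) k

open TensorProduct in
theorem gp_tensor_inj [IsNoetherianRing A] (N E : Type u) [AddCommGroup N] [Module A N]
    [AddCommGroup E] [Module A E] [Module.Flat A N] (hE : Module.Injective A E) :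
    Module.Injective A (N ⊗[A] E) := by
  apply Module.Baer.injective
  intro 𝔞 g
  obtain ⟨l, s, hs⟩ := Module.Finite.exists_fin (R := A) (M := 𝔞)
  let a : Fin l → A := fun i => s i
  obtain ⟨m, b, hb0, hb⟩ := gp_rel_gens a
  let α : E →ₗ[A] (Fin l → E) := LinearMap.pi fun i => a i • LinearMap.id
  let β : (Fin l → E) →ₗ[A] (Fin m → E) :=
    LinearMap.pi fun j => ∑ i, b j i • LinearMap.proj i
  have hex : Function.Exact α β := by
    intro y
    constructor
    · intro h
      obtain ⟨x, hx⟩ := gp_inj_exact hE a b hb y (fun j => by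
        have := congrFun h j
        simpa [β] using this)
      exact ⟨x, by ext i; simp [α, hx]⟩
    · rintro ⟨x, rfl⟩
      ext j
      simp only [β, α, LinearMap.pi_apply, LinearMap.sum_apply, LinearMap.smul_apply,
        LinearMap.proj_apply, LinearMap.id_apply, smul_smul, ← Finset.sum_smul, hb0, zero_smul,
        Pi.zero_apply]
  have hex' := Module.Flat.lTensor_exact N hex
  let e1 := TensorProduct.piRight A A N (fun _ : Fin l => E)
  let e2 := TensorProduct.piRight A A N (fun _ : Fin m => E)
  have h1 : ∀ (z : N ⊗[A] (Fin l → E)) j, e2 (β.lTensor N z) j = ∑ i, b j i • e1 z i := by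
    intro z j
    induction z using TensorProduct.induction_on with
    | zero => simp
    | add x y hx hy => simp only [map_add, Pi.add_apply, hx, hy, smul_add, Finset.sum_add_distrib]
    | tmul n y => simp [e1, e2, β, TensorProduct.tmul_sum]
  have h2 : ∀ (z : N ⊗[A] E) i, e1 (α.lTensor N z) i = a i • z := by
    intro z i
    induction z using TensorProduct.induction_on with
    | zero => simp
    | add x y hx hy => simp only [map_add, Pi.add_apply, hx, hy, smul_add]
    | tmul n y => simp [e1, α]
  obtain ⟨x, hx⟩ := (hex' (e1.symm fun i => g (s i))).1 (by
    apply e2.injective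
    rw [map_zero]
    funext j
    rw [h1]
    simp only [LinearEquiv.apply_symm_apply, Pi.zero_apply, ← map_smul, ← map_sum]
    have : ∑ i, b j i • s i = 0 := Subtype.ext (by simpa using hb0 j)
    rw [this, map_zero])
  refine ⟨LinearMap.toSpanSingleton A _ x, fun r hr => ?_⟩
  have : LinearMap.toSpanSingleton A _ x ∘ₗ 𝔞.subtype = g := by
    refine LinearMap.ext_on_range hs fun i => ?_
    have := h2 x i
    rw [hx, LinearEquiv.apply_symm_apply] at this
    rw [this]; rfl
  exact LinearMap.congr_fun this ⟨r, hr⟩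

end

section
variable {A : Type u} [CommRing A]

theorem gp_hull_aux {I : Type u} [AddCommGroup I] [Module A I] (hI : Module.Injective A I)
    (e0 : I) :
    ∃ E : Submodule A I, e0 ∈ E ∧ Module.Injective A E ∧
      ∀ x ∈ E, x ≠ 0 → ∃ a b : A, a • x = b • e0 ∧ b • e0 ≠ 0 := by
  let S : Set (Submodule A I) := {E | e0 ∈ E ∧
      ∀ x ∈ E, x ≠ 0 → ∃ a b : A, a • x = b • e0 ∧ b • e0 ≠ 0}
  have hS0 : Submodule.span A {e0} ∈ S := by
    refine ⟨Submodule.mem_span_singleton_self e0, fun x hx hx0 => ?_⟩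
    obtain ⟨b, rfl⟩ := Submodule.mem_span_singleton.1 hx
    exact ⟨1, b, by simp, hx0⟩
  obtain ⟨E, -, hE⟩ := zorn_le_nonempty₀ S (by
    intro c hcS hc y hy
    refine ⟨sSup c, ⟨?_, ?_⟩, fun z hz => le_sSup hz⟩
    · exact (le_sSup hy : y ≤ sSup c) (hcS hy).1
    · intro x hx hx0
      obtain ⟨z, hz, hxz⟩ := (Submodule.mem_sSup_of_directed ⟨y, hy⟩ hc.directedOn).1 hx
      exact (hcS hz).2 x hxz hx0) _ hS0
  have hES : E ∈ S := hE.1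
  obtain ⟨K, -, hK⟩ := zorn_le_nonempty₀ {K : Submodule A I | Disjoint E K} (by
    intro c hcS hc y hy
    refine ⟨sSup c, ?_, fun z hz => le_sSup hz⟩
    exact (DirectedOn.disjoint_sSup_right hc.directedOn).2 fun b hb => hcS hb) ⊥ disjoint_bot_right
  have hKd : Disjoint E K := hK.1
  obtain ⟨h, hh⟩ := hI.out (K.mkQ ∘ₗ E.subtype) (by
    rw [← LinearMap.ker_eq_bot, LinearMap.ker_eq_bot']
    intro x hx
    have : (x : I) ∈ K := by simpa using hx
    exact Subtype.ext (Submodule.disjoint_def.1 hKd x x.2 this)) E.subtype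
  let φ : I →ₗ[A] I := h ∘ₗ K.mkQ
  have hφE : ∀ x ∈ E, φ x = x := fun x hx => hh ⟨x, hx⟩
  have hφK : ∀ x, φ x = 0 → x ∈ K := by
    intro x hx
    refine hK.2 (y := LinearMap.ker φ) ?_ ?_ hx
    · change Disjoint E (LinearMap.ker φ)
      rw [Submodule.disjoint_def]
      intro z hz hz'
      rw [← hφE z hz]; exact hz'
    · intro z hz
      have : K.mkQ z = 0 := by simpa using hz
      rw [LinearMap.mem_ker, LinearMap.comp_apply, this, map_zero]
  have hφK' : ∀ x ∈ K, φ x = 0 := by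
    intro z hz
    have : K.mkQ z = 0 := by simpa using hz
    rw [LinearMap.comp_apply, this, map_zero]
  have hR : LinearMap.range φ ∈ S := by
    refine ⟨⟨e0, hφE _ hES.1⟩, ?_⟩
    rintro _ ⟨x, rfl⟩ hx0
    have hxK : x ∉ K := fun hx => hx0 (hφK' x hx)
    have hnd : ¬ Disjoint E (K ⊔ Submodule.span A {x}) := by
      intro hd
      exact hxK (hK.2 hd le_sup_left (Submodule.mem_sup_right (Submodule.mem_span_singleton_self x)))
    rw [Submodule.disjoint_def] at hnd
    push Not at hnd
    obtain ⟨z, hzE, hz, hz0⟩ := hnd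
    obtain ⟨k, hk, w, hw, rfl⟩ := Submodule.mem_sup.1 hz
    obtain ⟨c, rfl⟩ := Submodule.mem_span_singleton.1 hw
    obtain ⟨a, b, hab, hb⟩ := hES.2 _ hzE hz0
    refine ⟨a * c, b, ?_, hb⟩
    rw [← hab, ← hφE _ hzE, map_add, hφK' k hk, zero_add, map_smul, smul_smul]
  have hRE : LinearMap.range φ ≤ E := hE.2 hR (fun x hx => ⟨x, hφE x hx⟩)
  refine ⟨E, hES.1, ⟨?_⟩, hES.2⟩
  intro X Y _ _ _ _ f hf g
  obtain ⟨h', hh'⟩ := hI.out f hf (E.subtype ∘ₗ g)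
  refine ⟨LinearMap.codRestrict E (φ ∘ₗ h') (fun y => hRE ⟨_, rfl⟩), fun x => Subtype.ext ?_⟩
  rw [LinearMap.codRestrict_apply, LinearMap.comp_apply, hh']
  exact hφE _ (g x).2

theorem gp_hull (p : Ideal A) :
    ∃ (E : Type u) (_ : AddCommGroup E) (_ : Module A E) (e : E), Module.Injective A E ∧
      (∀ a : A, a • e = 0 ↔ a ∈ p) ∧
      ∀ x : E, x ≠ 0 → ∃ a b : A, a • x = b • e ∧ b • e ≠ 0 := by
  obtain ⟨I, _, _, i, hI, hi⟩ := gp_embed A (A ⧸ p)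
  let e0 : I := i (Ideal.Quotient.mk p 1)
  obtain ⟨E, he, hE, hess⟩ := gp_hull_aux hI e0
  refine ⟨E, inferInstance, inferInstance, ⟨e0, he⟩, hE, fun a => ?_, fun x hx => ?_⟩
  · rw [← Ideal.Quotient.eq_zero_iff_mem, Subtype.ext_iff]
    change a • e0 = 0 ↔ _
    rw [← map_smul, map_eq_zero_iff i hi]
    rw [← Ideal.Quotient.mk_eq_mk, ← Submodule.Quotient.mk_smul, smul_eq_mul, mul_one]
    exact Iff.rfl
  · obtain ⟨a, b, h1, h2⟩ := hess x x.2 (fun h => hx (Subtype.ext h))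
    exact ⟨a, b, Subtype.ext h1, fun h => h2 (congrArg Subtype.val h)⟩

/-- hull data -/
structure GPHull (A : Type u) [CommRing A] (p : Ideal A) where
  E : Type u
  [i1 : AddCommGroup E]
  [i2 : Module A E]
  e : E
  inj : Module.Injective A E
  ann : ∀ a : A, a • e = 0 ↔ a ∈ p
  ess : ∀ x : E, x ≠ 0 → ∃ a b : A, a • x = b • e ∧ b • e ≠ 0

attribute [instance] GPHull.i1 GPHull.i2

theorem gp_hull_nonempty (p : Ideal A) : Nonempty (GPHull A p) := by
  obtain ⟨E, i1, i2, e, h1, h2, h3⟩ := gp_hull p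
  exact ⟨@GPHull.mk A _ p E i1 i2 e h1 h2 h3⟩

/-- `s ∉ p` acts injectively -/
theorem GPHull.smul_inj {p : Ideal A} [hp : p.IsPrime] (H : GPHull A p) {s : A} (hs : s ∉ p)
    (x : H.E) (hx : s • x = 0) : x = 0 := by
  by_contra hx0
  obtain ⟨a, b, h1, h2⟩ := H.ess x hx0
  have : (s * b) • H.e = 0 := by rw [mul_smul, ← h1, smul_comm, hx, smul_zero]
  rw [H.ann] at this
  rcases hp.mem_or_mem this with h | h
  · exact hs h
  · exact h2 ((H.ann b).2 h)

theorem GPHull.nil [IsNoetherianRing A] {p : Ideal A} [hp : p.IsPrime] (H : GPHull A p)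
    (x : H.E) : ∃ k : ℕ, ∀ a ∈ p ^ k, a • x = 0 := by
  have h1 : ∀ s ∈ p, ∃ k : ℕ, s ^ k • x = 0 := by
    intro s hs
    let f : ℕ →o Ideal A := ⟨fun k => LinearMap.ker (LinearMap.toSpanSingleton A H.E (s ^ k • x)), by
      refine monotone_nat_of_le_succ fun k a ha => ?_
      have ha' : a • s ^ k • x = 0 := by simpa using ha
      have : a • s ^ (k + 1) • x = 0 := by
        rw [pow_succ', mul_smul, smul_comm, ha', smul_zero]
      simpa using this⟩
    obtain ⟨n, hn⟩ := monotone_stabilizes_iff_noetherian.2 (inferInstance : IsNoetherian A A) f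
    refine ⟨n, ?_⟩
    by_contra hne
    obtain ⟨a, b, h1, h2⟩ := H.ess _ hne
    have h3 : a ∈ f (n + 1) := by
      have : a • s ^ (n + 1) • x = 0 := by
        rw [pow_succ', mul_smul, smul_comm, h1, smul_comm, (H.ann s).2 hs, smul_zero]
      simpa [f] using this
    rw [← hn (n + 1) (Nat.le_succ n)] at h3
    have h4 : a • s ^ n • x = 0 := by simpa [f] using h3
    exact h2 (h1 ▸ h4)
  let J : Ideal A := LinearMap.ker (LinearMap.toSpanSingleton A H.E x)
  obtain ⟨k, hk⟩ := Ideal.exists_pow_le_of_le_radical_of_fg (I := p) (J := J) (by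
    intro s hs
    obtain ⟨k, hk⟩ := h1 s hs
    exact ⟨k, by simpa [J] using hk⟩) (IsNoetherian.noetherian p)
  exact ⟨k, fun a ha => by simpa [J] using hk ha⟩

/-- elements of the socle -/
theorem GPHull.soc {p : Ideal A} [hp : p.IsPrime] (H : GPHull A p)
    (x : H.E) (hx : ∀ a ∈ p, a • x = 0) : ∃ a b : A, a ∉ p ∧ a • x = b • H.e := by
  by_cases hx0 : x = 0
  · exact ⟨1, 0, fun h => hp.ne_top ((Ideal.eq_top_iff_one p).2 h), by simp [hx0]⟩
  · obtain ⟨a, b, h1, h2⟩ := H.ess x hx0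
    exact ⟨a, b, fun ha => h2 (by rw [← h1]; exact hx a ha), h1⟩

end

section
variable {A : Type u} [CommRing A]

theorem gp_quot_flat {P : Type u} [AddCommGroup P] [Module A P] [Module.Flat A P]
    (H : Submodule A P)
    (h : ∀ (l : ℕ) (a : Fin l → A) (p : Fin l → P), ∑ i, a i • p i ∈ H →
      ∃ h : Fin l → P, (∀ i, h i ∈ H) ∧ ∑ i, a i • h i = ∑ i, a i • p i) :
    Module.Flat A (P ⧸ H) := by
  refine Module.Flat.of_forall_isTrivialRelation fun {l a x} hx => ?_
  choose p hp using fun i => H.mkQ_surjective (x i)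
  obtain ⟨h', hH, hh⟩ := h l a p (by
    rw [← Submodule.ker_mkQ H, LinearMap.mem_ker, map_sum]
    simpa only [map_smul, hp] using hx)
  obtain ⟨k, b, y, h1, h2⟩ := Module.Flat.isTrivialRelation_of_sum_smul_eq_zero
    (f := a) (x := fun i => p i - h' i) (by simp only [smul_sub, Finset.sum_sub_distrib, hh, sub_self])
  refine ⟨k, b, fun j => H.mkQ (y j), fun i => ?_, h2⟩
  have h3 : H.mkQ (h' i) = 0 := by simpa using hH i
  have := congrArg H.mkQ (h1 i)
  rw [map_sub, h3, sub_zero, hp] at this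
  rw [this]; simp only [map_sum, map_smul]

theorem gp_mem_smul_top {N : Type u} [AddCommGroup N] [Module A N] {l : ℕ} (a : Fin l → A)
    (n : N) (hn : n ∈ Ideal.span (Set.range a) • (⊤ : Submodule A N)) :
    ∃ m : Fin l → N, n = ∑ i, a i • m i := by
  let f : (Fin l → N) →ₗ[A] N := ∑ i, a i • LinearMap.proj i
  have : Ideal.span (Set.range a) • (⊤ : Submodule A N) ≤ LinearMap.range f := by
    rw [Submodule.smul_le]
    intro r hr n _
    obtain ⟨c, hc⟩ := (Submodule.mem_span_range_iff_exists_fun A).1 hr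
    refine ⟨fun i => c i • n, ?_⟩
    rw [← hc, Finset.sum_smul]
    simp only [f, LinearMap.sum_apply, LinearMap.smul_apply, LinearMap.proj_apply, smul_smul,
      smul_eq_mul, mul_comm]
  obtain ⟨m, hm⟩ := this hn
  exact ⟨m, by rw [← hm]; simp [f]⟩

theorem gp_smul_top_of_primes [IsNoetherianRing A] {N : Type u} [AddCommGroup N] [Module A N]
    (I : Ideal A) (h : ∀ q : PrimeSpectrum A, I ≤ q.asIdeal → q.asIdeal • (⊤ : Submodule A N) = ⊤) :
    I • (⊤ : Submodule A N) = ⊤ := by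
  induction I using IsNoetherian.induction with
  | hgt I' ih =>
    let I : Ideal A := I'
    change I • (⊤ : Submodule A N) = ⊤
    by_cases hI : I = ⊤
    · rw [hI, Submodule.top_smul]
    by_cases hp : I.IsPrime
    · exact h ⟨I, hp⟩ le_rfl
    · rw [Ideal.isPrime_iff] at hp
      push Not at hp
      obtain ⟨x, y, hxy, hx, hy⟩ := hp hI
      have hlt : ∀ z ∉ I, I < I ⊔ Ideal.span {z} := fun z hz =>
        lt_of_le_of_ne le_sup_left fun he => hz (by
          rw [he]; exact Ideal.mem_sup_right (Ideal.mem_span_singleton_self z))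
      have h1 := ih _ (hlt x hx) (fun q hq => h q (le_sup_left.trans hq))
      have h2 := ih _ (hlt y hy) (fun q hq => h q (le_sup_left.trans hq))
      have h3 : (I ⊔ Ideal.span {x}) * (I ⊔ Ideal.span {y}) ≤ I := by
        rw [Ideal.mul_sup, Ideal.sup_mul, Ideal.sup_mul, Ideal.span_singleton_mul_span_singleton]
        refine sup_le (sup_le ?_ ?_) (sup_le ?_ ?_)
        · exact Ideal.mul_le_inf.trans inf_le_left
        · exact Ideal.mul_le_inf.trans inf_le_right
        · exact Ideal.mul_le_inf.trans inf_le_left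
        · exact (Ideal.span_singleton_le_iff_mem _).2 hxy
      rw [eq_top_iff]
      calc ⊤ = (I ⊔ Ideal.span {x}) • (I ⊔ Ideal.span {y}) • (⊤ : Submodule A N) := by rw [h2, h1]
        _ = ((I ⊔ Ideal.span {x}) * (I ⊔ Ideal.span {y})) • (⊤ : Submodule A N) := by
          rw [← Submodule.mul_smul]
        _ ≤ _ := Submodule.smul_mono_left h3

open TensorProduct

theorem gp_fg_inj [IsNoetherianRing A] (H : ∀ q : PrimeSpectrum A, GPHull A q.asIdeal)
    {N C : Type u} [AddCommGroup N] [Module A N] [AddCommGroup C] [Module A C] [Module.Flat A N]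
    [Module.Flat A C] (ι : N →ₗ[A] C) (ev : ∀ q, C →ₗ[A] ((H q).E →ₗ[A] N ⊗[A] (H q).E))
    (hev : ∀ q n x, ev q (ι n) x = n ⊗ₜ x)
    (X : Type u) [AddCommGroup X] [Module A X] [hX : Module.Finite A X] :
    Function.Injective (ι.rTensor X) := by
  induction hX using IsNoetherianRing.induction_on_isQuotientEquivQuotientPrime A with
  | subsingleton X =>
    exact Function.injective_of_subsingleton _
  | quotient X q f =>
    have hq0 : q.asIdeal ≤ LinearMap.ker (LinearMap.toSpanSingleton A _ (H q).e) := by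
      intro a ha; simpa using ((H q).ann a).2 ha
    let j : X →ₗ[A] (H q).E :=
      (q.asIdeal.liftQ (LinearMap.toSpanSingleton A _ (H q).e) hq0) ∘ₗ f.toLinearMap
    have hj : Function.Injective j := by
      refine Function.Injective.comp (g := (q.asIdeal.liftQ (LinearMap.toSpanSingleton A _ (H q).e) hq0))
        (f := f) ?_ f.injective
      rw [← LinearMap.ker_eq_bot]
      refine Submodule.ker_liftQ_eq_bot _ _ _ ?_
      intro a ha
      exact ((H q).ann a).1 (by simpa using ha)
    have h1 := Module.Flat.lTensor_preserves_injective_linearMap (M := N) j hj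
    have h2 : (TensorProduct.lift (ev q) ∘ₗ j.lTensor C) ∘ₗ ι.rTensor X = j.lTensor N := by
      ext n x
      simp [hev]
    rw [← h2] at h1
    exact Function.Injective.of_comp (f := (TensorProduct.lift (ev q) ∘ₗ j.lTensor C)) h1
  | exact X1 X2 X3 f g hf hg hfg h1 h3 =>
    rw [← LinearMap.ker_eq_bot, LinearMap.ker_eq_bot'] at h1 h3 ⊢
    intro z hz
    have e1 : g.lTensor N z = 0 := by
      apply h3
      rw [← LinearMap.comp_apply, LinearMap.rTensor_comp_lTensor, ← LinearMap.lTensor_comp_rTensor,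
        LinearMap.comp_apply, hz, map_zero]
    obtain ⟨w, rfl⟩ := (lTensor_exact N hfg hg z).1 e1
    rw [← LinearMap.comp_apply, LinearMap.rTensor_comp_lTensor, ← LinearMap.lTensor_comp_rTensor,
        LinearMap.comp_apply] at hz
    have := (map_eq_zero_iff _ (Module.Flat.lTensor_preserves_injective_linearMap (M := C) f hf)).1 hz
    rw [h1 w this, map_zero]

theorem gp_pure_of_fg {N C : Type u} [AddCommGroup N] [Module A N] [AddCommGroup C] [Module A C]
    (ι : N →ₗ[A] C) (h : ∀ I : Ideal A, Function.Injective (ι.rTensor (A ⧸ I)))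
    {l : ℕ} (a : Fin l → A) (c : Fin l → C) (n : N) (hn : ι n = ∑ i, a i • c i) :
    ∃ m : Fin l → N, n = ∑ i, a i • m i := by
  apply gp_mem_smul_top
  let I := Ideal.span (Set.range a)
  have h1 : (n ⊗ₜ[A] (Submodule.Quotient.mk 1 : A ⧸ I)) = 0 := by
    apply h I
    rw [map_zero, LinearMap.rTensor_tmul, hn, TensorProduct.sum_tmul]
    refine Finset.sum_eq_zero fun i _ => ?_
    rw [TensorProduct.smul_tmul, ← Submodule.Quotient.mk_smul, smul_eq_mul, mul_one,
      (Submodule.Quotient.mk_eq_zero _).2 (Ideal.subset_span (Set.mem_range_self i)), TensorProduct.tmul_zero]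
  have h2 := congrArg (TensorProduct.tensorQuotEquivQuotSMul N I) h1
  rw [map_zero] at h2
  have h3 : (TensorProduct.tensorQuotEquivQuotSMul N I) (n ⊗ₜ[A] (Submodule.Quotient.mk 1 : A ⧸ I))
    = Submodule.Quotient.mk ((1 : A) • n) := by
    exact TensorProduct.tensorQuotEquivQuotSMul_tmul_mk (M := N) I n 1
  rw [h3, one_smul] at h2
  exact (Submodule.Quotient.mk_eq_zero _).1 h2

end

section
variable {A : Type u} [CommRing A]
open TensorProduct

theorem gp_smul_top_tmul {N E : Type u} [AddCommGroup N] [Module A N]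
    [AddCommGroup E] [Module A E] (I : Ideal A) (x : E) (hx : ∀ a ∈ I, a • x = 0) (n : N)
    (hn : n ∈ I • (⊤ : Submodule A N)) : n ⊗ₜ[A] x = 0 := by
  refine Submodule.smul_induction_on hn ?_ ?_
  · intro a ha m _
    rw [TensorProduct.smul_tmul, hx a ha, TensorProduct.tmul_zero]
  · intro a b ha hb
    rw [TensorProduct.add_tmul, ha, hb, add_zero]

theorem gp_ideal_gens [IsNoetherianRing A] (p : Ideal A) :
    ∃ (l : ℕ) (a : Fin l → A), Ideal.span (Set.range a) = p :=
  Submodule.fg_iff_exists_fin_generating_family.1 (IsNoetherian.noetherian p)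

theorem gp_socle_tensor [IsNoetherianRing A] {N : Type u} [AddCommGroup N] [Module A N]
    [Module.Flat A N] {p : Ideal A} [hp : p.IsPrime] (H : GPHull A p)
    (hN : ∀ s ∉ p, ∀ n : N, ∃ n' m, m ∈ p • (⊤ : Submodule A N) ∧ n = s • n' + m)
    (z : N ⊗[A] H.E) (hz : ∀ a ∈ p, a • z = 0) : ∃ n : N, z = n ⊗ₜ H.e := by
  obtain ⟨l, a, ha⟩ := gp_ideal_gens p
  let α : H.E →ₗ[A] (Fin l → H.E) := LinearMap.pi fun i => a i • LinearMap.id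
  let e1 := TensorProduct.piRight A A N (fun _ : Fin l => H.E)
  have h2 : ∀ (z : N ⊗[A] H.E) i, e1 (α.lTensor N z) i = a i • z := by
    intro z i
    induction z using TensorProduct.induction_on with
    | zero => simp
    | add x y hx hy => simp only [map_add, Pi.add_apply, hx, hy, smul_add]
    | tmul n y => simp [e1, α]
  have hex : Function.Exact (LinearMap.ker α).subtype α := LinearMap.exact_subtype_ker_map α
  obtain ⟨w, rfl⟩ := (Module.Flat.lTensor_exact N hex z).1 (by
    apply e1.injective
    funext i
    rw [h2, hz _ (by rw [← ha]; exact Ideal.subset_span (Set.mem_range_self i)), map_zero]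
    rfl)
  clear hz
  induction w using TensorProduct.induction_on with
  | zero => exact ⟨0, by simp⟩
  | add x y hx hy =>
    obtain ⟨n, hn⟩ := hx
    obtain ⟨m, hm⟩ := hy
    exact ⟨n + m, by rw [map_add, hn, hm, TensorProduct.add_tmul]⟩
  | tmul n x =>
    have hx : ∀ b ∈ p, b • (x : H.E) = 0 := by
      have : p ≤ LinearMap.ker (LinearMap.toSpanSingleton A H.E (x : H.E)) := by
        refine ha.symm.trans_le (Ideal.span_le.2 ?_)
        rintro _ ⟨i, rfl⟩
        have := congrFun (LinearMap.mem_ker.1 x.2) i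
        simpa [α] using this
      intro b hb
      simpa using this hb
    obtain ⟨s, b, hs, hsb⟩ := H.soc x hx
    obtain ⟨n', m, hm, rfl⟩ := hN s hs n
    refine ⟨b • n', ?_⟩
    rw [LinearMap.lTensor_tmul, TensorProduct.add_tmul, Submodule.subtype_apply,
      gp_smul_top_tmul p _ hx m hm, add_zero, TensorProduct.smul_tmul, hsb, TensorProduct.smul_tmul]

/-- vanishing condition -/
def GPV (A : Type u) [CommRing A] (j : ℕ) (N : Type u) [AddCommGroup N] [Module A N] : Prop :=
  ∀ p : PrimeSpectrum A, Order.coheight p + 1 ≤ (j : ℕ∞) → p.asIdeal • (⊤ : Submodule A N) = ⊤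

theorem gp_step [IsNoetherianRing A] (j : ℕ) (N : Type u) [AddCommGroup N] [Module A N]
    [Module.Flat A N] (hV : GPV A j N) :
    ∃ (C N' : Type u) (_ : AddCommGroup C) (_ : Module A C) (_ : AddCommGroup N') (_ : Module A N')
      (ι : N →ₗ[A] C) (π : C →ₗ[A] N'), Function.Injective ι ∧ Function.Surjective π ∧
      Function.Exact ι π ∧ GPRelinj A C ∧ Module.Flat A N' ∧ GPV A (j + 1) N' := by
  let H := fun q : PrimeSpectrum A => (gp_hull_nonempty q.asIdeal).some
  let J := fun q => N ⊗[A] (H q).E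
  have hJ : ∀ q, Module.Injective A (J q) := fun q => gp_tensor_inj N _ (H q).inj
  let C := ∀ q, (H q).E →ₗ[A] J q
  have hCf : Module.Flat A C := gp_pi_hom_flat _ _ (fun q => (H q).inj) hJ
  have hCr : GPRelinj A C := gp_pi_hom_relinj _ _ (fun q => (H q).inj) hJ
  let ι : N →ₗ[A] C := LinearMap.pi fun q => TensorProduct.mk A N (H q).E
  have hfg := fun (X : Type u) [AddCommGroup X] [Module A X] [Module.Finite A X] =>
    gp_fg_inj H ι (fun q => LinearMap.proj q) (fun q n x => rfl) X
  have hpure := fun (l : ℕ) (a : Fin l → A) => gp_pure_of_fg ι (fun I => hfg (A ⧸ I)) a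
  refine ⟨C, C ⧸ LinearMap.range ι, inferInstance, inferInstance, inferInstance, inferInstance,
    ι, (LinearMap.range ι).mkQ, ?_, Submodule.mkQ_surjective _, ?_, hCr, ?_, ?_⟩
  · rw [← LinearMap.ker_eq_bot, LinearMap.ker_eq_bot']
    intro n hn
    obtain ⟨m, hm⟩ := hpure 0 (fun _ => 0) (fun _ => 0) n (by simpa using hn)
    simpa using hm
  · rw [LinearMap.exact_iff, Submodule.ker_mkQ]
  · refine gp_quot_flat _ fun l a c hc => ?_
    obtain ⟨n, hn⟩ := hc
    obtain ⟨m, hm⟩ := hpure l a c n hn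
    exact ⟨fun i => ι (m i), fun i => ⟨_, rfl⟩, by rw [← hn, hm]; simp only [map_sum, map_smul]⟩
  · intro p hpj
    have hpj' : Order.coheight p ≤ j := by
      have : Order.coheight p + 1 ≤ (j : ℕ∞) + 1 := by simpa using hpj
      exact (ENat.add_le_add_iff_right (by simp)).1 this
    have hlt : ∀ q : PrimeSpectrum A, p < q → q.asIdeal • (⊤ : Submodule A N) = ⊤ := fun q hq =>
      hV q ((Order.coheight_add_one_le hq).trans hpj')
    have hN : ∀ s ∉ p.asIdeal, ∀ n : N, ∃ n' m, m ∈ p.asIdeal • (⊤ : Submodule A N) ∧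
        n = s • n' + m := by
      intro s hs n
      have := gp_smul_top_of_primes (N := N) (p.asIdeal ⊔ Ideal.span {s}) (fun q hq => hlt q (by
        refine lt_of_le_of_ne (le_sup_left.trans hq) ?_
        rintro rfl
        exact hs (hq (Ideal.mem_sup_right (Ideal.mem_span_singleton_self s)))))
      have hn : n ∈ (p.asIdeal ⊔ Ideal.span {s}) • (⊤ : Submodule A N) := by rw [this]; trivial
      rw [Submodule.sup_smul] at hn
      obtain ⟨m, hm, w, hw, rfl⟩ := Submodule.mem_sup.1 hn
      rw [Submodule.ideal_span_singleton_smul] at hw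
      obtain ⟨n', -, rfl⟩ := hw
      exact ⟨n', m, hm, add_comm _ _⟩
    obtain ⟨l, a, ha⟩ := gp_ideal_gens p.asIdeal
    -- main decomposition
    have key : ∀ c : C, ∃ n : N, ∀ q, ∀ x : (H q).E, (∀ b ∈ p.asIdeal, b • x = 0) →
        c q x = n ⊗ₜ x := by
      intro c
      obtain ⟨n, hn⟩ := gp_socle_tensor (H p) hN (c p (H p).e) (fun b hb => by
        rw [← map_smul, ((H p).ann b).2 hb, map_zero])
      refine ⟨n, fun q x hx => ?_⟩
      by_cases hpq : p.asIdeal ≤ q.asIdeal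
      · by_cases hpq' : p = q
        · subst hpq'
          obtain ⟨s, b, hs, hsb⟩ := (H p).soc x hx
          have hinj : Function.Injective ((s • LinearMap.id : (H p).E →ₗ[A] (H p).E).lTensor N) := by
            apply Module.Flat.lTensor_preserves_injective_linearMap
            rw [← LinearMap.ker_eq_bot, LinearMap.ker_eq_bot']
            intro y hy
            exact (H p).smul_inj hs y (by simpa using hy)
          apply hinj
          simp only [LinearMap.lTensor_smul, LinearMap.lTensor_id, LinearMap.smul_apply,
            LinearMap.id_apply]
          rw [← map_smul, hsb, map_smul, hn, ← TensorProduct.tmul_smul, ← TensorProduct.tmul_smul,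
            hsb]
        · have h0 := hlt q (lt_of_le_of_ne hpq hpq')
          have h0k : ∀ k : ℕ, q.asIdeal ^ k • (⊤ : Submodule A N) = ⊤ := by
            intro k
            induction k with
            | zero => simp
            | succ k ih => rw [pow_succ, Submodule.mul_smul, h0, ih]
          have hsub : ∀ z : N ⊗[A] (H q).E, z = 0 := by
            intro z
            induction z using TensorProduct.induction_on with
            | zero => rfl
            | add x y hx hy => rw [hx, hy, add_zero]
            | tmul n x =>
              obtain ⟨k, hk⟩ := (H q).nil x
              exact gp_smul_top_tmul _ x hk n (by rw [h0k]; trivial)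
          exact (hsub (c q x)).trans (hsub _).symm
      · obtain ⟨s, hsp, hsq⟩ := Set.not_subset.1 hpq
        have : x = 0 := (H q).smul_inj hsq x (hx s hsp)
        rw [this, map_zero, TensorProduct.tmul_zero]
    have hvan : ∀ c : C, (∀ q, ∀ x : (H q).E, (∀ b ∈ p.asIdeal, b • x = 0) → c q x = 0) →
        c ∈ p.asIdeal • (⊤ : Submodule A C) := by
      intro c hc
      have : ∀ q, ∃ g : Fin l → (H q).E →ₗ[A] J q, c q = ∑ i, a i • g i := by
        intro q
        let α : (H q).E →ₗ[A] (Fin l → (H q).E) := LinearMap.pi fun i => a i • LinearMap.id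
        obtain ⟨g, hg⟩ := gp_inj_factor (hJ q) α (c q) (by
          intro x hx
          refine hc q x ?_
          have : p.asIdeal ≤ LinearMap.ker (LinearMap.toSpanSingleton A (H q).E x) := by
            refine ha.symm.trans_le (Ideal.span_le.2 ?_)
            rintro _ ⟨i, rfl⟩
            have := congrFun (LinearMap.mem_ker.1 hx) i
            simpa [α] using this
          intro b hb
          simpa using this hb)
        refine ⟨fun i => g ∘ₗ LinearMap.single A (fun _ => (H q).E) i, ?_⟩
        rw [← hg]
        ext x
        have : α x = ∑ i, a i • Pi.single i x := by
          ext k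
          rw [Finset.sum_apply, Finset.sum_eq_single k]
          · simp [α]
          · intro i _ hi; simp [Ne.symm hi]
          · simp
        rw [LinearMap.comp_apply, this]
        simp
      choose g hg using this
      have : c = ∑ i, a i • (fun q => g q i : C) := by
        funext q; rw [hg]; simp
      rw [this]
      refine Submodule.sum_mem _ fun i _ => Submodule.smul_mem_smul ?_ trivial
      rw [← ha]; exact Ideal.subset_span (Set.mem_range_self i)
    rw [eq_top_iff]
    rintro x -
    obtain ⟨c, rfl⟩ := Submodule.mkQ_surjective _ x
    obtain ⟨n, hn⟩ := key c
    have h1 := hvan (c - ι n) (fun q x hx => by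
      have := hn q x hx
      change c q x - n ⊗ₜ x = 0
      rw [this, sub_self])
    have h2 : (LinearMap.range ι).mkQ c = (LinearMap.range ι).mkQ (c - ι n) := by
      have : (LinearMap.range ι).mkQ (ι n) = 0 := by simp
      rw [map_sub, this, sub_zero]
    rw [h2]
    have h3 := Submodule.mem_map_of_mem (f := (LinearMap.range ι).mkQ) h1
    rw [Submodule.map_smul''] at h3
    exact Submodule.smul_mono le_rfl le_top h3

/-- cotorsion-type dimension -/
def GPCotDim (A : Type u) [CommRing A] : ℕ → ∀ (N : Type u) [AddCommGroup N] [Module A N], Prop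
  | 0, N, _, _ => GPRelinj A N
  | n + 1, N, _, _ => ∃ (C N' : Type u) (_ : AddCommGroup C) (_ : Module A C)
      (_ : AddCommGroup N') (_ : Module A N')
      (ι : N →ₗ[A] C) (π : C →ₗ[A] N'), Function.Injective ι ∧ Function.Surjective π ∧
      Function.Exact ι π ∧ GPRelinj A C ∧ GPCotDim A n N'

theorem gp_cotDim [IsNoetherianRing A] (hdim : ringKrullDim A < ⊤) :
    ∃ n : ℕ, ∀ (N : Type u) [AddCommGroup N] [Module A N], Module.Flat A N → GPCotDim A n N := by
  have hd : ∃ d : ℕ, ∀ p : PrimeSpectrum A, Order.coheight p + 1 ≤ (d : ℕ∞) := by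
    by_cases h : Nonempty (PrimeSpectrum A)
    · have h1 : ∀ p : PrimeSpectrum A, (Order.coheight p : WithBot ℕ∞) ≤ ringKrullDim A :=
        fun p => Order.coheight_le_krullDim p
      generalize hD : ringKrullDim A = D at h1 hdim
      induction D with
      | bot => exact absurd (h1 h.some) (by simp)
      | coe D =>
        have : D ≠ ⊤ := by rintro rfl; exact lt_irrefl _ hdim
        lift D to ℕ using this
        refine ⟨D + 1, fun p => ?_⟩
        have := WithBot.coe_le_coe.1 (h1 p)
        push_cast
        gcongr
    · exact ⟨0, fun p => absurd ⟨p⟩ h⟩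
  obtain ⟨d, hd⟩ := hd
  refine ⟨d, ?_⟩
  have main : ∀ k j : ℕ, k + j = d → ∀ (N : Type u) [AddCommGroup N] [Module A N],
      Module.Flat A N → GPV A j N → GPCotDim A k N := by
    intro k
    induction k with
    | zero =>
      intro j hj N _ _ hN hV
      have h0 : (⊥ : Ideal A) • (⊤ : Submodule A N) = ⊤ :=
        gp_smul_top_of_primes _ fun q _ => hV q (by
          have : j = d := by omega
          rw [this]; exact hd q)
      rw [Submodule.bot_smul] at h0
      have : Subsingleton N := ⟨fun x y => by
        have h : ∀ z : N, z = 0 := fun z => by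
          have : z ∈ (⊤ : Submodule A N) := trivial
          rw [← h0] at this; simpa using this
        rw [h x, h y]⟩
      intro K P _ _ _ _ i _ f
      exact ⟨0, LinearMap.ext fun x => Subsingleton.elim _ _⟩
    | succ k ih =>
      intro j hj N _ _ hN hV
      obtain ⟨C, N', _, _, _, _, ι, π, h1, h2, h3, h4, h5, h6⟩ := gp_step j N hV
      exact ⟨C, N', _, _, _, _, ι, π, h1, h2, h3, h4, ih (j + 1) (by omega) N' h5 h6⟩
  intro N _ _ hN
  refine main d 0 rfl N hN fun p hp => ?_
  simp at hp

end

section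
variable {A : Type u} [CommRing A]
open TensorProduct

theorem gp_pres (A : Type u) [CommRing A] (X : Type u) [AddCommGroup X] [Module A X] :
    ∃ (L F : Type u) (_ : AddCommGroup L) (_ : Module A L) (_ : AddCommGroup F) (_ : Module A F)
      (j : L →ₗ[A] F) (q : F →ₗ[A] X), Function.Injective j ∧ Function.Surjective q ∧
      Function.Exact j q ∧ Module.Projective A F := by
  let q : (X →₀ A) →ₗ[A] X := Finsupp.linearCombination A id
  have hq : Function.Surjective q := Finsupp.linearCombination_id_surjective A X
  exact ⟨LinearMap.ker q, X →₀ A, inferInstance, inferInstance, inferInstance, inferInstance,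
    (LinearMap.ker q).subtype, q,
    Submodule.injective_subtype _, hq, LinearMap.exact_subtype_ker_map q, inferInstance⟩

theorem gp_flat_tor {K P K' X : Type u} [AddCommGroup K] [Module A K] [AddCommGroup P] [Module A P]
    [AddCommGroup K'] [Module A K'] [AddCommGroup X] [Module A X] [Module.Flat A K']
    (i : K →ₗ[A] P) (π : P →ₗ[A] K') (hi : Function.Injective i) (hπ : Function.Surjective π)
    (hex : Function.Exact i π) : Function.Injective (i.rTensor X) := by
  obtain ⟨L, F, _, _, _, _, j, q, hj, hq, hLq, hF⟩ := gp_pres A X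
  rw [← LinearMap.ker_eq_bot, LinearMap.ker_eq_bot']
  intro z hz
  obtain ⟨z', rfl⟩ := LinearMap.lTensor_surjective K hq z
  rw [← LinearMap.comp_apply, LinearMap.rTensor_comp_lTensor, ← LinearMap.lTensor_comp_rTensor,
    LinearMap.comp_apply] at hz
  have hexP : Function.Exact (j.lTensor P) (q.lTensor P) := lTensor_exact P hLq hq
  obtain ⟨w, hw⟩ := (hexP _).1 hz
  have h1 : π.rTensor L w = 0 := by
    apply Module.Flat.lTensor_preserves_injective_linearMap (M := K') j hj
    rw [map_zero, ← LinearMap.comp_apply, LinearMap.lTensor_comp_rTensor,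
      ← LinearMap.rTensor_comp_lTensor, LinearMap.comp_apply, hw]
    exact (rTensor_exact (F) hex hπ _).2 ⟨_, rfl⟩
  obtain ⟨w', rfl⟩ := (rTensor_exact L hex hπ _).1 h1
  have h2 : j.lTensor K w' = z' := by
    apply Module.Flat.rTensor_preserves_injective_linearMap (M := F) i hi
    rw [← hw, ← LinearMap.comp_apply, LinearMap.rTensor_comp_lTensor,
      ← LinearMap.lTensor_comp_rTensor, LinearMap.comp_apply]
  rw [← h2]
  exact (lTensor_exact K hLq hq _).2 ⟨_, rfl⟩

theorem gp_flat_ker {K P K' : Type u} [AddCommGroup K] [Module A K] [AddCommGroup P] [Module A P]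
    [AddCommGroup K'] [Module A K'] [Module.Flat A P] [Module.Flat A K']
    (i : K →ₗ[A] P) (π : P →ₗ[A] K') (hi : Function.Injective i) (hπ : Function.Surjective π)
    (hex : Function.Exact i π) : Module.Flat A K := by
  rw [Module.Flat.iff_lTensor_preserves_injective_linearMap]
  intro X Y _ _ _ _ j hj
  have h1 : Function.Injective (i.rTensor Y ∘ₗ j.lTensor K) := by
    rw [LinearMap.rTensor_comp_lTensor, ← LinearMap.lTensor_comp_rTensor]
    exact (Module.Flat.lTensor_preserves_injective_linearMap (M := P) j hj).comp
      (gp_flat_tor (X := X) i π hi hπ hex)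
  exact Function.Injective.of_comp (f := i.rTensor Y) h1

/-- syzygies -/
def GPSyz (A : Type u) [CommRing A] : ℕ → ∀ (N : Type u) [AddCommGroup N] [Module A N], Prop
  | 0, N, _, _ => Module.Flat A N
  | n + 1, N, _, _ => ∃ (P K' : Type u) (_ : AddCommGroup P) (_ : Module A P)
      (_ : AddCommGroup K') (_ : Module A K')
      (ι : N →ₗ[A] P) (π : P →ₗ[A] K'), Function.Injective ι ∧ Function.Surjective π ∧
      Function.Exact ι π ∧ Module.Projective A P ∧ GPSyz A n K'

theorem GPSyz.flat (n : ℕ) : ∀ (N : Type u) [AddCommGroup N] [Module A N], GPSyz A n N →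
    Module.Flat A N := by
  induction n with
  | zero => intro N _ _ h; exact h
  | succ n ih =>
    rintro N _ _ ⟨P, K', _, _, _, _, ι, π, h1, h2, h3, h4, h5⟩
    have := ih K' h5
    exact gp_flat_ker ι π h1 h2 h3

/-- descending a map along a surjection -/
theorem gp_desc {K P K' N : Type u} [AddCommGroup K] [Module A K] [AddCommGroup P] [Module A P]
    [AddCommGroup K'] [Module A K'] [AddCommGroup N] [Module A N]
    (i : K →ₗ[A] P) (π : P →ₗ[A] K') (hπ : Function.Surjective π)
    (hex : Function.Exact i π) (f : P →ₗ[A] N) (hf : f ∘ₗ i = 0) :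
    ∃ g : K' →ₗ[A] N, g ∘ₗ π = f := by
  have hk : LinearMap.ker π ≤ LinearMap.ker f := by
    intro x hx
    obtain ⟨k, rfl⟩ := (hex x).1 hx
    exact LinearMap.congr_fun hf k
  refine ⟨(LinearMap.ker π).liftQ f hk ∘ₗ (π.quotKerEquivOfSurjective hπ).symm.toLinearMap,
    LinearMap.ext fun x => ?_⟩
  have : (π.quotKerEquivOfSurjective hπ).symm (π x) = Submodule.Quotient.mk x := by
    rw [LinearEquiv.symm_apply_eq]; rfl
  simp [this]

/-- lifting a map to a kernel -/
theorem gp_lift_ker {K P K' N : Type u} [AddCommGroup K] [Module A K] [AddCommGroup P] [Module A P]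
    [AddCommGroup K'] [Module A K'] [AddCommGroup N] [Module A N]
    (i : K →ₗ[A] P) (π : P →ₗ[A] K') (hi : Function.Injective i)
    (hex : Function.Exact i π) (f : N →ₗ[A] P) (hf : π ∘ₗ f = 0) :
    ∃ g : N →ₗ[A] K, i ∘ₗ g = f := by
  have : ∀ x, f x ∈ LinearMap.range i := fun x => (hex (f x)).1 (LinearMap.congr_fun hf x)
  refine ⟨(LinearEquiv.ofInjective i hi).symm.toLinearMap ∘ₗ f.codRestrict _ this,
    LinearMap.ext fun x => ?_⟩
  have h := LinearEquiv.apply_symm_apply (LinearEquiv.ofInjective i hi) (f.codRestrict _ this x)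
  exact congrArg Subtype.val h

theorem gp_ext (n : ℕ) : ∀ (N : Type u) [AddCommGroup N] [Module A N], GPCotDim A n N →
    ∀ (K P K' : Type u) [AddCommGroup K] [Module A K] [AddCommGroup P] [Module A P]
    [AddCommGroup K'] [Module A K'] (i : K →ₗ[A] P) (p : P →ₗ[A] K'),
    Function.Injective i → Function.Surjective p → Function.Exact i p → GPSyz A n K' →
    ∀ f : K →ₗ[A] N, ∃ g : P →ₗ[A] N, g ∘ₗ i = f := by
  induction n with
  | zero =>
    intro N _ _ hN K P K' _ _ _ _ _ _ i p hi hp hex hK f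
    have : Module.Flat A K' := hK
    exact hN K P i (fun I _ _ _ => gp_flat_tor i p hi hp hex) f
  | succ n ih =>
    intro N _ _ hN K P K' _ _ _ _ _ _ i p hi hp hex hK f
    have : Module.Flat A K' := hK.flat
    obtain ⟨C, N', _, _, _, _, ι, π, hι, hπ, hιπ, hC, hN'⟩ := hN
    obtain ⟨P', K'', _, _, _, _, i', p', hi', hp', hex', hP', hK''⟩ := hK
    obtain ⟨g, hg⟩ := hC K P i (fun I _ _ _ => gp_flat_tor i p hi hp hex) (ι ∘ₗ f)
    obtain ⟨g', hg'⟩ := gp_desc i p hp hex (π ∘ₗ g) (by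
      rw [LinearMap.comp_assoc, hg, ← LinearMap.comp_assoc, hιπ.linearMap_comp_eq_zero,
        LinearMap.zero_comp])
    obtain ⟨g2, hg2⟩ := ih N' hN' K' P' K'' i' p' hi' hp' hex' hK'' g'
    obtain ⟨ĝ, hĝ⟩ := Module.projective_lifting_property π g2 hπ
    obtain ⟨k, hk⟩ := gp_lift_ker ι π hι hιπ (g - ĝ ∘ₗ i' ∘ₗ p) (by
      rw [LinearMap.comp_sub, ← LinearMap.comp_assoc, hĝ, ← LinearMap.comp_assoc, hg2, hg', sub_self])
    refine ⟨k, LinearMap.ext fun x => hι ?_⟩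
    have h1 := LinearMap.congr_fun hk (i x)
    have h2 := LinearMap.congr_fun hg x
    have h3 : p (i x) = 0 := hex.apply_apply_eq_zero x
    simp only [LinearMap.comp_apply, LinearMap.sub_apply, h3, map_zero, sub_zero] at h1 h2 ⊢
    rw [h1, h2]

theorem gp_flat_induction [IsNoetherianRing A] (hdim : ringKrullDim A < ⊤)
    (Q : ∀ (L : Type u) [AddCommGroup L] [Module A L], Prop)
    (h0 : ∀ (L : Type u) [AddCommGroup L] [Module A L], Module.Projective A L → Q L)
    (hs : ∀ (L : Type u) [AddCommGroup L] [Module A L], Module.Flat A L →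
      (∀ (K P : Type u) [AddCommGroup K] [Module A K] [AddCommGroup P] [Module A P]
        (i : K →ₗ[A] P) (p : P →ₗ[A] L), Function.Injective i → Function.Surjective p →
        Function.Exact i p → Module.Projective A P → Q K) → Q L)
    (L : Type u) [AddCommGroup L] [Module A L] (hL : Module.Flat A L) : Q L := by
  obtain ⟨n, hn⟩ := gp_cotDim (A := A) hdim
  have main : ∀ m k : ℕ, m + k = n → ∀ (L : Type u) [AddCommGroup L] [Module A L],
      GPSyz A k L → Q L := by
    intro m
    induction m with
    | zero =>
      intro k hk L _ _ hL
      obtain rfl : k = n := by omega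
      have : Module.Flat A L := hL.flat
      apply h0
      obtain ⟨K, F, _, _, _, _, j, q, hj, hq, hex, hF⟩ := gp_pres A L
      have hKf := gp_flat_ker j q hj hq hex
      obtain ⟨g, hg⟩ := gp_ext k K (hn K hKf) K F L j q hj hq hex
        hL LinearMap.id
      obtain ⟨s, hs⟩ := gp_desc j q hq hex
        (LinearMap.id - j ∘ₗ g) (by
        rw [LinearMap.sub_comp, LinearMap.comp_assoc, hg, LinearMap.id_comp,
          LinearMap.comp_id, sub_self])
      refine Module.Projective.of_split s q (LinearMap.ext fun x => ?_)
      obtain ⟨y, rfl⟩ := hq x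
      have := LinearMap.congr_fun hs y
      rw [LinearMap.comp_apply] at this
      rw [LinearMap.comp_apply, this]
      simp [hex.apply_apply_eq_zero]
    | succ m ih =>
      intro k hk L _ _ hL
      refine hs L hL.flat ?_
      intro K P _ _ _ _ i p hi hp hex hP
      exact ih (k + 1) (by omega) K ⟨P, L, _, _, _, _, i, p, hi, hp, hex, hP, hL⟩
  exact main n 0 rfl L hL

/-- strongly Gorenstein projective datum -/
def GPSGP (A : Type u) [CommRing A] (P : Type u) [AddCommGroup P] [Module A P]
    (d : P →ₗ[A] P) : Prop :=
  Module.Projective A P ∧ Function.Exact d d ∧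
  ∀ (Q : Type u) [AddCommGroup Q] [Module A Q], Module.Projective A Q →
    ∀ f : P →ₗ[A] Q, f ∘ₗ d = 0 → ∃ g : P →ₗ[A] Q, g ∘ₗ d = f

/-- flat datum -/
def GPF (A : Type u) [CommRing A] (T : Type u) [AddCommGroup T] [Module A T]
    (d : T →ₗ[A] T) : Prop :=
  Module.Flat A T ∧ Function.Exact d d ∧
  ∀ (I : Type u) [AddCommGroup I] [Module A I], Module.Injective A I →
    Function.Exact (d.rTensor I) (d.rTensor I)

/-- orthogonal modules -/
def GPOrth (A : Type u) [CommRing A] (L : Type u) [AddCommGroup L] [Module A L] : Prop :=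
  ∀ (P : Type u) [AddCommGroup P] [Module A P] (d : P →ₗ[A] P), GPSGP A P d →
    ∀ f : P →ₗ[A] L, f ∘ₗ d = 0 → ∃ g : P →ₗ[A] L, g ∘ₗ d = f

theorem GPOrth.coker {L1 R L : Type u} [AddCommGroup L1] [Module A L1] [AddCommGroup R] [Module A R]
    [AddCommGroup L] [Module A L] (ι : L1 →ₗ[A] R) (π : R →ₗ[A] L)
    (hι : Function.Injective ι) (hπ : Function.Surjective π) (hex : Function.Exact ι π)
    (h1 : GPOrth A L1) (hR : GPOrth A R) : GPOrth A L := by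
  intro P _ _ d hP f hf
  have := hP.1
  obtain ⟨f', hf'⟩ := Module.projective_lifting_property π f hπ
  obtain ⟨k, hk⟩ := gp_lift_ker ι π hι hex (f' ∘ₗ d) (by
    rw [← LinearMap.comp_assoc, hf', hf])
  have hdd : d ∘ₗ d = 0 := hP.2.1.linearMap_comp_eq_zero
  obtain ⟨k', hk'⟩ := h1 P d hP k (by
    refine LinearMap.ext fun x => hι ?_
    have := LinearMap.congr_fun hk (d x)
    have h2 := LinearMap.congr_fun hdd x
    simp only [LinearMap.comp_apply, LinearMap.zero_apply] at this h2 ⊢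
    rw [this, h2, map_zero, map_zero])
  obtain ⟨g, hg⟩ := hR P d hP (f' - ι ∘ₗ k') (by
    rw [LinearMap.sub_comp, LinearMap.comp_assoc, hk', hk, sub_self])
  refine ⟨π ∘ₗ g, ?_⟩
  rw [LinearMap.comp_assoc, hg, LinearMap.comp_sub, ← LinearMap.comp_assoc,
    hex.linearMap_comp_eq_zero, hf', LinearMap.zero_comp, sub_zero]

theorem gp_flat_orth [IsNoetherianRing A] (hdim : ringKrullDim A < ⊤)
    (L : Type u) [AddCommGroup L] [Module A L] (hL : Module.Flat A L) : GPOrth A L := by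
  refine gp_flat_induction hdim (fun L _ _ => GPOrth A L) ?_ ?_ L hL
  · intro L _ _ hL P _ _ d hP f hf
    exact hP.2.2 L hL f hf
  · intro L _ _ hL ih
    obtain ⟨K, F, _, _, _, _, j, q, hj, hq, hex, hF⟩ := gp_pres A L
    have h1 := ih K F j q hj hq hex hF
    refine GPOrth.coker j q hj hq hex h1 ?_
    intro P _ _ d hP f hf
    exact hP.2.2 _ inferInstance f hf

theorem GPSGP.gpf [IsNoetherianRing A] (hdim : ringKrullDim A < ⊤)
    {P : Type u} [AddCommGroup P] [Module A P] {d : P →ₗ[A] P} (h : GPSGP A P d) : GPF A P d := by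
  have := h.1
  refine ⟨inferInstance, h.2.1, ?_⟩
  intro I _ _ hI
  have hdd : d ∘ₗ d = 0 := h.2.1.linearMap_comp_eq_zero
  have hdd' : d.rTensor I ∘ₗ d.rTensor I = 0 := by
    rw [← LinearMap.rTensor_comp, hdd, LinearMap.rTensor_zero]
  intro z
  constructor
  · intro hz
    obtain ⟨J, _, _, j, hJ, hj⟩ := gp_embed A ((P ⊗[A] I) ⧸ LinearMap.range (d.rTensor I))
    let F : P ⊗[A] I →ₗ[A] J := j ∘ₗ (LinearMap.range (d.rTensor I)).mkQ
    obtain ⟨g, hg⟩ := gp_flat_orth hdim _ (gp_hom_flat I J hI hJ) P d h (TensorProduct.curry F) (by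
      ext x y
      have : (LinearMap.range (d.rTensor I)).mkQ (d x ⊗ₜ y) = 0 := by
        rw [Submodule.mkQ_apply, Submodule.Quotient.mk_eq_zero]
        exact ⟨x ⊗ₜ y, by simp⟩
      simp only [LinearMap.comp_apply, TensorProduct.curry_apply, F, this, map_zero,
        LinearMap.zero_apply])
    have h1 : F = TensorProduct.lift g ∘ₗ d.rTensor I := by
      apply TensorProduct.ext'
      intro x y
      have := LinearMap.congr_fun (LinearMap.congr_fun hg x) y
      simpa using this.symm
    have h2 : F z = 0 := by rw [h1, LinearMap.comp_apply, hz, map_zero]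
    have h3 : (LinearMap.range (d.rTensor I)).mkQ z = 0 := hj (by rw [map_zero]; exact h2)
    simpa using h3
  · rintro ⟨y, rfl⟩
    exact LinearMap.congr_fun hdd' y

theorem GPF.sgp [IsNoetherianRing A] (hdim : ringKrullDim A < ⊤)
    {P : Type u} [AddCommGroup P] [Module A P] {d : P →ₗ[A] P} (h : GPF A P d)
    (hP : Module.Projective A P) : GPSGP A P d := by
  refine ⟨hP, h.2.1, ?_⟩
  intro Q _ _ hQ
  obtain ⟨n, hn⟩ := gp_cotDim (A := A) hdim
  have main : ∀ (n : ℕ) (N : Type u) [AddCommGroup N] [Module A N], GPCotDim A n N →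
      ∀ f : P →ₗ[A] N, f ∘ₗ d = 0 → ∃ g : P →ₗ[A] N, g ∘ₗ d = f := by
    intro n
    -- relinj case
    have hR : ∀ (N : Type u) [AddCommGroup N] [Module A N], GPRelinj A N →
      ∀ f : P →ₗ[A] N, f ∘ₗ d = 0 → ∃ g : P →ₗ[A] N, g ∘ₗ d = f := by
      intro N _ _ hN f hf
      have hsurj : Function.Surjective d.rangeRestrict := d.surjective_rangeRestrict
      have hex : Function.Exact d d.rangeRestrict := by
        intro x
        rw [← h.2.1 x]
        exact ⟨fun hx => congrArg Subtype.val hx, fun hx => Subtype.ext hx⟩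
      obtain ⟨f', hf'⟩ := gp_desc d d.rangeRestrict hsurj hex f hf
      obtain ⟨g, hg⟩ := hN (LinearMap.range d) P (LinearMap.range d).subtype (by
        intro I _ _ hI
        rw [← LinearMap.ker_eq_bot, LinearMap.ker_eq_bot']
        intro z hz
        obtain ⟨w, rfl⟩ := LinearMap.rTensor_surjective I hsurj z
        rw [← LinearMap.comp_apply, ← LinearMap.rTensor_comp] at hz
        have : d.rTensor I w = 0 := hz
        exact (rTensor_exact I hex hsurj w).2 ((h.2.2 I hI w).1 this)) f'
      exact ⟨g, by rw [← hf', ← hg]; rfl⟩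
    induction n with
    | zero => intro N _ _ hN; exact hR N hN
    | succ n ih =>
      rintro N _ _ ⟨C, N', _, _, _, _, ι, π, hι, hπ, hιπ, hC, hN'⟩ f hf
      obtain ⟨g, hg⟩ := hR C hC (ι ∘ₗ f) (by rw [LinearMap.comp_assoc, hf, LinearMap.comp_zero])
      obtain ⟨g', hg'⟩ := ih N' hN' (π ∘ₗ g) (by
        rw [LinearMap.comp_assoc, hg, ← LinearMap.comp_assoc, hιπ.linearMap_comp_eq_zero,
          LinearMap.zero_comp])
      obtain ⟨g2, hg2⟩ := Module.projective_lifting_property π g' hπ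
      obtain ⟨k, hk⟩ := gp_lift_ker ι π hι hιπ (g - g2 ∘ₗ d) (by
        rw [LinearMap.comp_sub, ← LinearMap.comp_assoc, hg2, hg', sub_self])
      refine ⟨k, LinearMap.ext fun x => hι ?_⟩
      have h1 := LinearMap.congr_fun hk (d x)
      have h2 := LinearMap.congr_fun hg x
      have h3 : d (d x) = 0 := h.2.1.apply_apply_eq_zero x
      simp only [LinearMap.comp_apply, LinearMap.sub_apply, h3, map_zero, sub_zero] at h1 h2 ⊢
      rw [h1, h2]
  exact main n Q (hn Q inferInstance)

end

section
variable {A : Type u} [CommRing A]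
open TensorProduct

/-- short exact sequence -/
def GPSes {K P L : Type u} [AddCommGroup K] [Module A K] [AddCommGroup P] [Module A P]
    [AddCommGroup L] [Module A L] (i : K →ₗ[A] P) (p : P →ₗ[A] L) : Prop :=
  Function.Injective i ∧ Function.Surjective p ∧ Function.Exact i p

theorem gp_diff_ker {K P L : Type u} [AddCommGroup K] [Module A K] [AddCommGroup P] [Module A P]
    [AddCommGroup L] [Module A L] {i : K →ₗ[A] P} {p : P →ₗ[A] L} (h : GPSes i p)
    (dK : K →ₗ[A] K) (dP : P →ₗ[A] P) (dL : L →ₗ[A] L)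
    (hi : i ∘ₗ dK = dP ∘ₗ i) (hp : p ∘ₗ dP = dL ∘ₗ p)
    (hP : Function.Exact dP dP) (hL : Function.Exact dL dL) : Function.Exact dK dK := by
  have hi' : ∀ x, i (dK x) = dP (i x) := fun x => LinearMap.congr_fun hi x
  have hp' : ∀ x, p (dP x) = dL (p x) := fun x => LinearMap.congr_fun hp x
  intro z
  constructor
  · intro hz
    obtain ⟨w, hw⟩ := (hP (i z)).1 (by rw [← hi', hz, map_zero])
    obtain ⟨t, ht⟩ := (hL (p w)).1 (by rw [← hp', hw]; exact h.2.2.apply_apply_eq_zero z)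
    obtain ⟨v, rfl⟩ := h.2.1 t
    obtain ⟨y, hy⟩ := (h.2.2 (w - dP v)).1 (by rw [map_sub, hp', ht, sub_self])
    refine ⟨y, h.1 ?_⟩
    rw [hi', hy, map_sub, hw, hP.apply_apply_eq_zero, sub_zero]
  · rintro ⟨y, rfl⟩
    apply h.1
    rw [hi', hi', hP.apply_apply_eq_zero, map_zero]

theorem gpf_ker {K P L : Type u} [AddCommGroup K] [Module A K] [AddCommGroup P] [Module A P]
    [AddCommGroup L] [Module A L] {i : K →ₗ[A] P} {p : P →ₗ[A] L} (h : GPSes i p)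
    (dK : K →ₗ[A] K) (dP : P →ₗ[A] P) (dL : L →ₗ[A] L)
    (hi : i ∘ₗ dK = dP ∘ₗ i) (hp : p ∘ₗ dP = dL ∘ₗ p)
    (hP : GPF A P dP) (hL : GPF A L dL) : GPF A K dK := by
  have := hP.1
  have := hL.1
  refine ⟨gp_flat_ker i p h.1 h.2.1 h.2.2, gp_diff_ker h dK dP dL hi hp hP.2.1 hL.2.1, ?_⟩
  intro I _ _ hI
  refine gp_diff_ker (i := i.rTensor I) (p := p.rTensor I) ⟨gp_flat_tor i p h.1 h.2.1 h.2.2,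
    LinearMap.rTensor_surjective I h.2.1, rTensor_exact I h.2.2 h.2.1⟩ _ (dP.rTensor I)
    (dL.rTensor I) ?_ ?_ (hP.2.2 I hI) (hL.2.2 I hI)
  · rw [← LinearMap.rTensor_comp, ← LinearMap.rTensor_comp, hi]
  · rw [← LinearMap.rTensor_comp, ← LinearMap.rTensor_comp, hp]

/-- contractible differential -/
def gpDelta (A : Type u) [CommRing A] (F : Type u) [AddCommGroup F] [Module A F] :
    F × F →ₗ[A] F × F := LinearMap.inr A F F ∘ₗ LinearMap.fst A F F

theorem gp_exact_of_htpy {T : Type u} [AddCommGroup T] [Module A T] (d s : T →ₗ[A] T)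
    (hd : d ∘ₗ d = 0) (hs : d ∘ₗ s + s ∘ₗ d = LinearMap.id) : Function.Exact d d := by
  intro z
  constructor
  · intro hz
    have := LinearMap.congr_fun hs z
    simp only [LinearMap.add_apply, LinearMap.comp_apply, hz, map_zero, add_zero,
      LinearMap.id_apply] at this
    exact ⟨_, this⟩
  · rintro ⟨y, rfl⟩
    exact LinearMap.congr_fun hd y

theorem gpf_delta (F : Type u) [AddCommGroup F] [Module A F] [Module.Projective A F] :
    GPF A (F × F) (gpDelta A F) := by
  let s : F × F →ₗ[A] F × F := LinearMap.inl A F F ∘ₗ LinearMap.snd A F F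
  have hd : gpDelta A F ∘ₗ gpDelta A F = 0 := by
    apply LinearMap.ext; rintro ⟨x, y⟩; simp [gpDelta]
  have hs : gpDelta A F ∘ₗ s + s ∘ₗ gpDelta A F = LinearMap.id := by
    apply LinearMap.ext; rintro ⟨x, y⟩; simp [gpDelta, s]
  refine ⟨?_, gp_exact_of_htpy _ s hd hs, fun I _ _ _ => gp_exact_of_htpy _ (s.rTensor I) ?_ ?_⟩
  · exact Module.Flat.of_projective
  · rw [← LinearMap.rTensor_comp, hd, LinearMap.rTensor_zero]
  · rw [← LinearMap.rTensor_comp, ← LinearMap.rTensor_comp, ← LinearMap.rTensor_add, hs,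
      LinearMap.rTensor_id]

theorem GPSes.exact_comp {G Q : Type u} [AddCommGroup G] [Module A G] [AddCommGroup Q] [Module A Q]
    {i : G →ₗ[A] Q} {p : Q →ₗ[A] G} (h : GPSes i p) : Function.Exact (i ∘ₗ p) (i ∘ₗ p) := by
  intro z
  simp only [LinearMap.comp_apply, map_eq_zero_iff i h.1, Set.mem_range]
  rw [h.2.2 z]
  constructor
  · rintro ⟨y, rfl⟩
    obtain ⟨w, rfl⟩ := h.2.1 y
    exact ⟨w, rfl⟩
  · rintro ⟨y, rfl⟩
    exact ⟨_, rfl⟩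

theorem GPSes.prod_delta {G Q : Type u} [AddCommGroup G] [Module A G] [AddCommGroup Q] [Module A Q]
    {i : G →ₗ[A] Q} {p : Q →ₗ[A] G} (h : GPSes i p) (hQ : GPSGP A Q (i ∘ₗ p))
    (F : Type u) [AddCommGroup F] [Module A F] (hF : Module.Projective A F) :
    GPSes (i.prodMap (LinearMap.inr A F F)) (p.prodMap (LinearMap.fst A F F)) ∧
    GPSGP A (Q × (F × F)) (i.prodMap (LinearMap.inr A F F) ∘ₗ p.prodMap (LinearMap.fst A F F)) := by
  have hses : GPSes (i.prodMap (LinearMap.inr A F F)) (p.prodMap (LinearMap.fst A F F)) := by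
    refine ⟨?_, ?_, ?_⟩
    · rintro ⟨a, b⟩ ⟨a', b'⟩ hab
      simp only [LinearMap.prodMap_apply, LinearMap.inr_apply, Prod.mk.injEq] at hab
      rw [h.1 hab.1, hab.2.2]
    · rintro ⟨a, b⟩
      obtain ⟨a, rfl⟩ := h.2.1 a
      exact ⟨(a, (b, 0)), rfl⟩
    · rintro ⟨a, b, c⟩
      simp only [LinearMap.prodMap_apply, LinearMap.fst_apply, Prod.mk_eq_zero, Set.mem_range,
        Prod.exists, LinearMap.inr_apply, Prod.mk.injEq]
      rw [h.2.2 a]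
      constructor
      · rintro ⟨⟨y, rfl⟩, rfl⟩
        exact ⟨y, c, rfl, rfl, rfl⟩
      · rintro ⟨y, c', rfl, rfl, rfl⟩
        exact ⟨⟨y, rfl⟩, rfl⟩
  refine ⟨hses, ?_, hses.exact_comp, ?_⟩
  · have := hQ.1
    infer_instance
  · intro R _ _ hR f hf
    obtain ⟨g1, hg1⟩ := hQ.2.2 R hR (f ∘ₗ LinearMap.inl A Q (F × F)) (by
      ext x
      have := LinearMap.congr_fun hf (x, 0)
      exact this)
    let g2 : F × F →ₗ[A] R := f ∘ₗ LinearMap.inr A Q (F × F) ∘ₗ LinearMap.inl A F F ∘ₗ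
      LinearMap.snd A F F
    refine ⟨g1.coprod g2, LinearMap.ext ?_⟩
    rintro ⟨a, b, c⟩
    have h1 := LinearMap.congr_fun hg1 a
    have h2 := LinearMap.congr_fun hf (0, (c, 0))
    simp only [LinearMap.comp_apply, LinearMap.prodMap_apply, LinearMap.fst_apply,
      LinearMap.inr_apply, LinearMap.inl_apply, map_zero, LinearMap.zero_apply] at h1 h2
    have h3 : ((a, b, c) : Q × F × F) = (a, 0) + (0, b, 0) + (0, 0, c) := by simp
    rw [h3, map_add f, map_add f, h2, add_zero, ← h1]
    simp [g2]

theorem gp_AB [IsNoetherianRing A] (hdim : ringKrullDim A < ⊤) (T : Type u) [AddCommGroup T]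
    [Module A T] (d : T →ₗ[A] T) (hT : GPF A T d) (Z : Type u) [AddCommGroup Z] [Module A Z]
    (i : Z →ₗ[A] T) (p : T →ₗ[A] Z) (hs : GPSes i p) (hd : d = i ∘ₗ p) :
    ∃ (G Q L : Type u) (_ : AddCommGroup G) (_ : Module A G) (_ : AddCommGroup Q) (_ : Module A Q)
      (_ : AddCommGroup L) (_ : Module A L) (iG : G →ₗ[A] Q) (pG : Q →ₗ[A] G) (κ : L →ₗ[A] G)
      (σ : G →ₗ[A] Z), GPSes iG pG ∧ GPSGP A Q (iG ∘ₗ pG) ∧ GPSes κ σ ∧ GPOrth A L := by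
  have key := gp_flat_induction hdim (fun T _ _ => ∀ (d : T →ₗ[A] T) (_ : GPF A T d)
    (Z : Type u) [AddCommGroup Z] [Module A Z]
    (i : Z →ₗ[A] T) (p : T →ₗ[A] Z) (_ : GPSes i p) (_ : d = i ∘ₗ p),
    ∃ (G Q L : Type u) (_ : AddCommGroup G) (_ : Module A G) (_ : AddCommGroup Q) (_ : Module A Q)
      (_ : AddCommGroup L) (_ : Module A L) (iG : G →ₗ[A] Q) (pG : Q →ₗ[A] G) (κ : L →ₗ[A] G)
      (σ : G →ₗ[A] Z), GPSes iG pG ∧ GPSGP A Q (iG ∘ₗ pG) ∧ GPSes κ σ ∧ GPOrth A L) ?_ ?_ T hT.1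
  · exact key d hT Z i p hs hd
  · intro T _ _ hTP d hT Z _ _ i p hs hd
    refine ⟨Z, T, PUnit.{u + 1}, inferInstance, inferInstance, inferInstance, inferInstance,
      inferInstance, inferInstance, i, p, 0, LinearMap.id, hs, hd ▸ hT.sgp hdim hTP, ⟨?_, ?_, ?_⟩, ?_⟩
    · exact Function.injective_of_subsingleton _
    · exact fun x => ⟨x, rfl⟩
    · intro x
      simp [eq_comm]
    · intro P _ _ d _ f _
      exact ⟨0, LinearMap.ext fun x => Subsingleton.elim _ _⟩
  · intro T _ _ hTf ih d hT Z _ _ i p hs hd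
    obtain ⟨-, F, -, -, _, _, -, π, -, hπ, -, hF⟩ := gp_pres A T
    have hidp : ∀ t, i (p t) = d t := fun t => by rw [hd]; rfl
    have hdd : ∀ t, d (d t) = 0 := hT.2.1.apply_apply_eq_zero
    let ρ : F × F →ₗ[A] T := π.coprod (d ∘ₗ π)
    have hρ : ∀ x y, ρ (x, y) = π x + d (π y) := fun x y => by simp [ρ]
    have hρs : Function.Surjective ρ := fun t => by
      obtain ⟨x, rfl⟩ := hπ t
      exact ⟨(x, 0), by simp [hρ]⟩
    let ρZ : F →ₗ[A] Z := p ∘ₗ π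
    have hρZs : Function.Surjective ρZ := hs.2.1.comp hπ
    let T1 := LinearMap.ker ρ
    let Z1 := LinearMap.ker ρZ
    let i1 : Z1 →ₗ[A] T1 := LinearMap.codRestrict T1 (LinearMap.inr A F F ∘ₗ Z1.subtype) (by
      intro x
      have hx : p (π x) = 0 := x.2
      have : ρ (0, x) = 0 := by rw [hρ, ← hidp, hx]; simp
      exact this)
    have hT1 : ∀ z : T1, π (z : F × F).1 + d (π (z : F × F).2) = 0 := fun z => by
      rw [← hρ]; exact z.2
    let p1 : T1 →ₗ[A] Z1 := LinearMap.codRestrict Z1 (LinearMap.fst A F F ∘ₗ T1.subtype) (by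
      intro z
      have h1 : i (p (π (z : F × F).1)) = 0 := by
        rw [hidp, eq_neg_of_add_eq_zero_left (hT1 z), map_neg, hdd, neg_zero]
      have h2 : p (π (z : F × F).1) = 0 := hs.1 (by rw [h1, map_zero])
      exact h2)
    have hs1 : GPSes i1 p1 := by
      refine ⟨?_, ?_, ?_⟩
      · intro x y hxy
        have := congrArg (fun z : T1 => (z : F × F).2) hxy
        exact Subtype.ext this
      · intro x
        have hx : p (π x) = 0 := x.2
        obtain ⟨t, ht⟩ := (hT.2.1 (π x)).1 (by rw [← hidp, hx, map_zero])
        obtain ⟨y, rfl⟩ := hπ t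
        have : ρ (x, -y) = 0 := by rw [hρ, map_neg, map_neg, ht, add_neg_cancel]
        exact ⟨⟨(x, -y), this⟩, rfl⟩
      · intro z
        constructor
        · intro hz
          have h1 : (z : F × F).1 = 0 := congrArg Subtype.val hz
          have h2 : p (π (z : F × F).2) = 0 := by
            have := hT1 z
            rw [h1, map_zero, zero_add, ← hidp] at this
            exact hs.1 (by rw [this, map_zero])
          exact ⟨⟨_, h2⟩, Subtype.ext (Prod.ext h1.symm rfl)⟩
        · rintro ⟨y, rfl⟩
          rfl
    have hses0 : GPSes T1.subtype ρ := ⟨T1.injective_subtype, hρs, LinearMap.exact_subtype_ker_map ρ⟩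
    have hF1 : GPF A T1 (i1 ∘ₗ p1) := by
      refine gpf_ker hses0 _ (gpDelta A F) d ?_ ?_ (gpf_delta F) hT
      · rfl
      · apply LinearMap.ext
        rintro ⟨x, y⟩
        simp [gpDelta, ρ, hdd]
    obtain ⟨G1, Q1, L1, _, _, _, _, _, _, iG, pG, κ, σ, hG, hQ, hκ, hL⟩ :=
      ih T1 (F × F) T1.subtype ρ hses0.1 hses0.2.1 hses0.2.2 inferInstance (i1 ∘ₗ p1) hF1 Z1 i1 p1
        hs1 rfl
    let w : G1 →ₗ[A] F := Z1.subtype ∘ₗ σ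
    have hpi : ∀ x, pG (iG x) = 0 := hG.2.2.apply_apply_eq_zero
    obtain ⟨g, hg⟩ := hQ.2.2 F hF (w ∘ₗ pG) (by
      ext x; simp [hpi])
    have hgi : ∀ a, g (iG a) = w a := by
      intro a
      obtain ⟨q, rfl⟩ := hG.2.1 a
      exact LinearMap.congr_fun hg q
    obtain ⟨h, hh⟩ := gp_desc iG pG hG.2.1 hG.2.2 (ρZ ∘ₗ g) (by
      ext a
      have : ρZ (w a) = 0 := (σ a).2
      simp [hgi, this])
    have hh' : ∀ q, h (pG q) = ρZ (g q) := fun q => LinearMap.congr_fun hh q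
    let τ : G1 × F →ₗ[A] Z := h.coprod ρZ
    have hτ : ∀ x y, τ (x, y) = h x + ρZ y := fun x y => by simp [τ]
    let L := LinearMap.ker τ
    obtain ⟨hses2, hsgp2⟩ := hG.prod_delta hQ F hF
    refine ⟨G1 × F, Q1 × (F × F), L, inferInstance, inferInstance, inferInstance, inferInstance,
      inferInstance, inferInstance, _, _, L.subtype, τ, hses2, hsgp2,
      ⟨L.injective_subtype, ?_, LinearMap.exact_subtype_ker_map τ⟩, ?_⟩
    · intro z
      obtain ⟨y, rfl⟩ := hρZs z
      exact ⟨(0, y), by simp [hτ]⟩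
    · let μ : Q1 →ₗ[A] L := LinearMap.codRestrict L (pG.prod (-g)) (by
        intro q
        have : τ (pG q, -g q) = 0 := by rw [hτ, hh', map_neg, add_neg_cancel]
        exact this)
      have hQo : GPOrth A Q1 := fun P _ _ d hP f hf => hP.2.2 Q1 hQ.1 f hf
      refine GPOrth.coker (iG ∘ₗ κ) μ (hG.1.comp hκ.1) ?_ ?_ hL hQo
      · rintro ⟨⟨x, y⟩, hxy⟩
        obtain ⟨q, rfl⟩ := hG.2.1 x
        have h1 : ρZ (g q + y) = 0 := by
          rw [map_add, ← hh', ← hτ]; exact hxy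
        obtain ⟨a, ha⟩ := hκ.2.1 ⟨g q + y, h1⟩
        have ha' : w a = g q + y := congrArg Subtype.val ha
        refine ⟨q - iG a, Subtype.ext (Prod.ext ?_ ?_)⟩
        · change pG (q - iG a) = pG q
          rw [map_sub, hpi, sub_zero]
        · change -g (q - iG a) = y
          rw [map_sub, hgi, ha']; abel
      · intro q
        constructor
        · intro hq
          have h1 : pG q = 0 := congrArg (fun z : L => (z : G1 × F).1) hq
          have h2 : -g q = 0 := congrArg (fun z : L => (z : G1 × F).2) hq
          obtain ⟨a, rfl⟩ := (hG.2.2 q).1 h1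
          rw [hgi, neg_eq_zero] at h2
          obtain ⟨b, rfl⟩ := (hκ.2.2 a).1 (Subtype.ext h2)
          exact ⟨b, rfl⟩
        · rintro ⟨b, rfl⟩
          have h3 : σ (κ b) = 0 := hκ.2.2.apply_apply_eq_zero b
          refine Subtype.ext (Prod.ext ?_ ?_)
          · exact hpi _
          · change -g (iG (κ b)) = 0
            rw [hgi]; simp [w, h3]

/-- lifting along an orthogonal epimorphism -/
theorem gp_orth_lift {G' P G L Z : Type u} [AddCommGroup G'] [Module A G'] [AddCommGroup P]
    [Module A P] [AddCommGroup G] [Module A G] [AddCommGroup L] [Module A L] [AddCommGroup Z]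
    [Module A Z] {i : G' →ₗ[A] P} {p : P →ₗ[A] G'} (h : GPSes i p) (hP : GPSGP A P (i ∘ₗ p))
    {κ : L →ₗ[A] G} {σ : G →ₗ[A] Z} (hκ : GPSes κ σ) (hL : GPOrth A L) (f : G' →ₗ[A] Z) :
    ∃ g : G' →ₗ[A] G, σ ∘ₗ g = f := by
  have := hP.1
  have hpi : ∀ x, p (i x) = 0 := h.2.2.apply_apply_eq_zero
  obtain ⟨f', hf'⟩ := Module.projective_lifting_property σ (f ∘ₗ p) hκ.2.1
  obtain ⟨k, hk⟩ := gp_lift_ker κ σ hκ.1 hκ.2.2 (f' ∘ₗ i ∘ₗ p) (by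
    rw [← LinearMap.comp_assoc, hf']; ext x; simp [hpi])
  obtain ⟨k', hk'⟩ := hL P _ hP k (by
    refine LinearMap.ext fun x => hκ.1 ?_
    have := LinearMap.congr_fun hk (i (p x))
    simp only [LinearMap.comp_apply, hpi, map_zero, LinearMap.zero_apply] at this ⊢
    exact this)
  obtain ⟨g, hg⟩ := gp_desc i p h.2.1 h.2.2 (f' - κ ∘ₗ k') (by
    refine LinearMap.ext fun a => ?_
    obtain ⟨q, rfl⟩ := h.2.1 a
    have h1 := LinearMap.congr_fun hk q
    have h2 := LinearMap.congr_fun hk' q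
    simp only [LinearMap.comp_apply, LinearMap.sub_apply, LinearMap.zero_apply] at h1 h2 ⊢
    rw [h2, h1, sub_self])
  refine ⟨g, LinearMap.ext fun a => ?_⟩
  obtain ⟨q, rfl⟩ := h.2.1 a
  have h1 := LinearMap.congr_fun hg q
  have h2 := LinearMap.congr_fun hf' q
  simp only [LinearMap.comp_apply, LinearMap.sub_apply] at h1 h2 ⊢
  rw [h1, map_sub, h2, hκ.2.2.apply_apply_eq_zero, sub_zero]

end

section
open TensorProduct

/-- purity for modules with endomorphism -/
def GPDPure {A : Type u} [CommRing A] {P : Type u} [AddCommGroup P] [Module A P] (d : P →ₗ[A] P)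
    (H : Submodule A P) : Prop :=
  (∀ h ∈ H, d h ∈ H) ∧
  ∀ (k l : ℕ) (b : A) (a : Fin k → Fin l → A) (y : Fin l → P) (t : Fin k → P),
    (∀ s, ∑ j, a s j • y j + b • d (t s) ∈ H) →
    ∃ (y' : Fin l → P) (t' : Fin k → P), (∀ j, y' j ∈ H) ∧ (∀ s, t' s ∈ H) ∧
      ∀ s, ∑ j, a s j • y' j + b • d (t' s) = ∑ j, a s j • y j + b • d (t s)

open Polynomial in
theorem gp_dpure_exists {A : Type u} [CommRing A] {P : Type u} [AddCommGroup P] [Module A P]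
    (d : P →ₗ[A] P) {N : Type u} [AddCommGroup N] [Module A N] (φ : P →ₗ[A] N) :
    ∃ H : Submodule A P, GPDPure d H ∧ (∀ m ∈ H, φ m = 0) ∧
      Cardinal.mk (P ⧸ H) ≤ 2 ^ max (2 ^ (max (Cardinal.mk (Polynomial A)) Cardinal.aleph0)) (Cardinal.mk N) := by
  let e := Module.AEval'.of d
  obtain ⟨H0, hp, h0, hc⟩ := gp_bbe (R := Polynomial A) (M := Module.AEval' d)
    (φ.toAddMonoidHom.comp e.symm.toLinearMap.toAddMonoidHom)
  have hX : ∀ x, e (d x) = (X : A[X]) • e x := fun x => (Module.AEval'.X_smul_of d x).symm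
  have hC : ∀ (a : A) x, e (a • x) = (C a : A[X]) • e x := fun a x => by
    rw [map_smul]; exact (Module.AEval.C_smul d a (e x)).symm
  let H : Submodule A P :=
    { carrier := {x | e x ∈ H0}
      add_mem' := fun {x y} hx hy => by
        change e (x + y) ∈ H0
        rw [map_add]; exact H0.add_mem hx hy
      zero_mem' := by
        change e 0 ∈ H0
        rw [map_zero]; exact H0.zero_mem
      smul_mem' := fun a x hx => by
        change e (a • x) ∈ H0
        rw [hC]; exact H0.smul_mem _ hx }
  have hH : ∀ x, x ∈ H ↔ e x ∈ H0 := fun x => Iff.rfl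
  refine ⟨H, ⟨?_, ?_⟩, ?_, ?_⟩
  · intro h hh
    rw [hH, hX]
    exact H0.smul_mem _ hh
  · intro k l b a y t hs
    classical
    have key : ∀ (s : Fin k) (y : Fin l → P) (t : Fin k → P),
        ∑ j : ULift.{u} (Fin l) ⊕ ULift.{u} (Fin k),
          (Sum.elim (fun j => C (a s j.down)) (fun s' => if s' = ULift.up s then C b * X else 0) j : A[X])
            • (Sum.elim (fun j => e (y j.down)) (fun s => e (t s.down)) j : Module.AEval' d)
        = e (∑ j, a s j • y j + b • d (t s)) := by
      intro s y t
      rw [Fintype.sum_sum_type, map_add, map_sum, hC, hX]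
      congr 1
      · simp only [Sum.elim_inl, ← hC]
        exact Equiv.ulift.sum_comp (fun j => e (a s j • y j))
      · simp [mul_smul]
    obtain ⟨z, hz, hzs⟩ := hp (ULift.{u} (Fin k)) (ULift.{u} (Fin l) ⊕ ULift.{u} (Fin k))
      (fun s => Sum.elim (fun j => C (a s.down j.down)) (fun s' => if s' = s then C b * X else 0))
      (Sum.elim (fun j => e (y j.down)) (fun s => e (t s.down))) (by
        rintro ⟨s⟩
        have := key s y t
        rw [this]
        exact hs s)
    refine ⟨fun j => e.symm (z (Sum.inl ⟨j⟩)), fun j => e.symm (z (Sum.inr ⟨j⟩)), ?_, ?_, ?_⟩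
    · intro j
      rw [hH, e.apply_symm_apply]; exact hz _
    · intro j
      rw [hH, e.apply_symm_apply]; exact hz _
    · intro s
      apply e.injective
      refine (key s (fun j => e.symm (z (Sum.inl ⟨j⟩))) (fun j => e.symm (z (Sum.inr ⟨j⟩)))).symm.trans (Eq.trans ?_ ((hzs ⟨s⟩).trans (key s y t)))
      refine Finset.sum_congr rfl ?_
      rintro (j | j) -
      · simp
      · simp
  · intro m hm
    exact h0 (e m) hm
  · refine le_trans (le_of_eq ?_) hc
    refine Cardinal.mk_congr ?_
    exact Quotient.congr e.toEquiv (by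
      intro x y
      rw [Submodule.quotientRel_def, Submodule.quotientRel_def, hH, map_sub]
      rfl)

variable {A : Type u} [CommRing A]

theorem gp_vanish {I H N : Type u} [AddCommGroup I] [Module A I] [AddCommGroup H] [Module A H]
    [AddCommGroup N] [Module A N] (f : H →ₗ[A] N) (w : H ⊗[A] I) (hw : f.rTensor I w = 0) :
    ∃ (k l : ℕ) (e : Fin k → I) (h : Fin k → H) (a : Fin k → Fin l → A) (y : Fin l → N),
      w = ∑ s, h s ⊗ₜ[A] e s ∧ (∀ s, f (h s) = ∑ j, a s j • y j) ∧ ∀ j, ∑ s, a s j • e s = 0 := by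
  obtain ⟨v, hv, hvw⟩ : ∃ v : I ⊗[A] H, f.lTensor I v = 0 ∧ TensorProduct.comm A I H v = w := by
    refine ⟨TensorProduct.comm A H I w, ?_, by simp⟩
    have h1 : f.lTensor I ∘ₗ (TensorProduct.comm A H I).toLinearMap =
      (TensorProduct.comm A N I).toLinearMap ∘ₗ f.rTensor I := by ext; simp
    have h2 := LinearMap.congr_fun h1 w
    simp only [LinearMap.comp_apply, hw, map_zero] at h2
    exact h2
  obtain ⟨J, hJ, hJw⟩ := TensorProduct.exists_finite_submodule_left_of_setFinite {v}
    (Set.finite_singleton _)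
  obtain ⟨w0, hw0⟩ := hJw rfl
  have h3 : J.subtype.rTensor N (f.lTensor J w0) = J.subtype.rTensor N 0 := by
    rw [map_zero, ← hv, ← hw0]
    rw [← LinearMap.comp_apply, ← LinearMap.comp_apply, LinearMap.rTensor_comp_lTensor,
      LinearMap.lTensor_comp_rTensor]
  obtain ⟨Q, hJQ, hQ, hQw⟩ := TensorProduct.eq_of_fg_of_subtype_eq (Module.Finite.iff_fg.1 hJ) h3
  let w1 : Q ⊗[A] H := (Submodule.inclusion hJQ).rTensor H w0
  have hw1 : f.lTensor Q w1 = 0 := by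
    rw [map_zero] at hQw
    rw [← hQw]
    simp only [w1]
    rw [← LinearMap.comp_apply, ← LinearMap.comp_apply, LinearMap.rTensor_comp_lTensor,
      LinearMap.lTensor_comp_rTensor]
  have hw1v : Q.subtype.rTensor H w1 = v := by
    rw [← hw0]
    simp only [w1]
    rw [← LinearMap.comp_apply, ← LinearMap.rTensor_comp]
    rfl
  have hQf : Module.Finite A Q := Module.Finite.iff_fg.2 hQ
  obtain ⟨k, e, he⟩ := Module.Finite.exists_fin (R := A) (M := Q)
  have hsum : ∀ z : Q ⊗[A] H, ∃ h : Fin k → H, z = ∑ s, e s ⊗ₜ[A] h s := by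
    intro z
    induction z with
    | zero => exact ⟨0, by simp⟩
    | add x y hx hy =>
      obtain ⟨h1, rfl⟩ := hx
      obtain ⟨h2, rfl⟩ := hy
      exact ⟨h1 + h2, by simp [tmul_add, Finset.sum_add_distrib]⟩
    | tmul x y =>
      have hx : x ∈ Submodule.span A (Set.range e) := by rw [he]; trivial
      obtain ⟨c, rfl⟩ := (Submodule.mem_span_range_iff_exists_fun A).1 hx
      exact ⟨fun s => c s • y, by simp [sum_tmul, smul_tmul]⟩
  obtain ⟨h, hh⟩ := hsum w1
  have h4 : ∑ s, e s ⊗ₜ[A] f (h s) = 0 := by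
    rw [hh] at hw1
    simpa using hw1
  obtain ⟨l, a, y, hy1, hy2⟩ := vanishesTrivially_of_sum_tmul_eq_zero A he h4
  refine ⟨k, l, fun s => e s, h, a, y, ?_, hy1, ?_⟩
  · rw [← hvw, ← hw1v, hh]
    simp
  · intro j
    have := congrArg Q.subtype (hy2 j)
    simpa using this

theorem gpf_quot {P : Type u} [AddCommGroup P] [Module A P] (d : P →ₗ[A] P) (hP : GPF A P d)
    (H : Submodule A P) (hH : GPDPure d H) :
    GPF A (P ⧸ H) (H.mapQ H d hH.1) := by
  have := hP.1
  have hdd : ∀ t, d (d t) = 0 := hP.2.1.apply_apply_eq_zero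
  have hbar : ∀ x, H.mapQ H d hH.1 (H.mkQ x) = H.mkQ (d x) := fun x => rfl
  have hmk : H.mapQ H d hH.1 ∘ₗ H.mkQ = H.mkQ ∘ₗ d := rfl
  refine ⟨?_, ?_, ?_⟩
  · refine gp_quot_flat H ?_
    intro l a p hp
    obtain ⟨y', t', h1, h2, h3⟩ := hH.2 1 l 0 (fun _ => a) p 0 (by simpa using hp)
    exact ⟨y', h1, by simpa using h3 0⟩
  · intro z
    obtain ⟨x, rfl⟩ := H.mkQ_surjective z
    constructor
    · intro hz
      rw [hbar, Submodule.mkQ_apply, Submodule.Quotient.mk_eq_zero] at hz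
      obtain ⟨y', t', h1, h2, h3⟩ := hH.2 1 0 1 (fun _ => Fin.elim0) Fin.elim0 (fun _ => x)
        (by simpa using hz)
      have h4 : d (t' 0) = d x := by simpa using h3 0
      obtain ⟨v, hv⟩ := (hP.2.1 (x - t' 0)).1 (by rw [map_sub, h4, sub_self])
      refine ⟨H.mkQ v, ?_⟩
      rw [hbar, hv, map_sub, sub_eq_self, Submodule.mkQ_apply, Submodule.Quotient.mk_eq_zero]
      exact h2 0
    · rintro ⟨y, hy⟩
      obtain ⟨y, rfl⟩ := H.mkQ_surjective y
      rw [← hy, hbar, hbar, hdd, map_zero]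
  · intro I _ _ hI
    have hbar' : ∀ x, (H.mapQ H d hH.1).rTensor I (H.mkQ.rTensor I x) =
        H.mkQ.rTensor I (d.rTensor I x) := fun x => by
      rw [← LinearMap.comp_apply, ← LinearMap.comp_apply, ← LinearMap.rTensor_comp,
        ← LinearMap.rTensor_comp, hmk]
    have hsurj : Function.Surjective (H.mkQ.rTensor I) :=
      LinearMap.rTensor_surjective I H.mkQ_surjective
    have hexH : Function.Exact (H.subtype.rTensor I) (H.mkQ.rTensor I) :=
      rTensor_exact I (LinearMap.exact_subtype_mkQ H) H.mkQ_surjective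
    have hexI := hP.2.2 I hI
    intro z
    obtain ⟨x, rfl⟩ := hsurj z
    constructor
    · intro hz
      rw [hbar'] at hz
      obtain ⟨w, hw⟩ := (hexH _).1 hz
      let R := LinearMap.range d
      have hRd : R.mkQ ∘ₗ d = 0 := by
        ext t
        simp [R]
      obtain ⟨k, l, e, h, a, y, hwe, hy, ha⟩ := gp_vanish (R.mkQ ∘ₗ H.subtype) w (by
        rw [LinearMap.rTensor_comp, LinearMap.comp_apply, hw, ← LinearMap.comp_apply,
          ← LinearMap.rTensor_comp, hRd, LinearMap.rTensor_zero, LinearMap.zero_apply])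
      choose y0 hy0 using fun j => R.mkQ_surjective (y j)
      have ht : ∀ s, ∃ t, ∑ j, a s j • y0 j + (1 : A) • d t = h s := by
        intro s
        have h1 : R.mkQ ((h s : P) - ∑ j, a s j • y0 j) = 0 := by
          rw [map_sub, sub_eq_zero, map_sum]
          simp only [map_smul, hy0]
          exact hy s
        rw [Submodule.mkQ_apply, Submodule.Quotient.mk_eq_zero] at h1
        obtain ⟨t, ht⟩ := h1
        exact ⟨t, by rw [ht, one_smul]; abel⟩
      choose t ht using ht
      obtain ⟨y', t', h1, h2, h3⟩ := hH.2 k l 1 a y0 t (fun s => by rw [ht]; exact (h s).2)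
      have h4 : d.rTensor I x = d.rTensor I (∑ s, t' s ⊗ₜ[A] e s) := by
        rw [← hw, hwe]
        simp only [map_sum, LinearMap.rTensor_tmul, Submodule.subtype_apply]
        have : ∀ s, (h s : P) ⊗ₜ[A] e s = ∑ j, y' j ⊗ₜ[A] (a s j • e s) + d (t' s) ⊗ₜ[A] e s := by
          intro s
          rw [← ht, ← h3, one_smul, add_tmul, sum_tmul]
          simp only [smul_tmul]
        simp only [this, Finset.sum_add_distrib]
        rw [Finset.sum_comm]
        simp only [← tmul_sum, ha, tmul_zero, Finset.sum_const_zero, zero_add]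
      obtain ⟨v, hv⟩ := (hexI (x - ∑ s, t' s ⊗ₜ[A] e s)).1 (by rw [map_sub, h4, sub_self])
      refine ⟨H.mkQ.rTensor I v, ?_⟩
      rw [hbar', hv, map_sub, sub_eq_self, map_sum]
      refine Finset.sum_eq_zero fun s _ => ?_
      rw [LinearMap.rTensor_tmul, Submodule.mkQ_apply, (Submodule.Quotient.mk_eq_zero H).2 (h2 s),
        zero_tmul]
    · rintro ⟨y, hy⟩
      obtain ⟨y, rfl⟩ := hsurj y
      rw [← hy, hbar', hbar', hexI.apply_apply_eq_zero, map_zero]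

theorem gp_exact_lmap {ι : Type u} (T : ι → Type u) [∀ i, AddCommGroup (T i)]
    [∀ i, Module A (T i)] (d : ∀ i, T i →ₗ[A] T i) (h : ∀ i, Function.Exact (d i) (d i)) :
    Function.Exact (DirectSum.lmap d) (DirectSum.lmap d) := by
  classical
  have hz : ∀ x, DirectSum.lmap d (DirectSum.lmap d x) = 0 := fun x =>
    DFinsupp.ext fun i => by
      change d i (d i (x i)) = 0
      exact (h i).apply_apply_eq_zero _
  intro z
  constructor
  · intro hzz
    have h1 : ∀ i, ∃ y, d i y = z i := fun i => ((h i) (z i)).1 (DFinsupp.ext_iff.1 hzz i)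
    choose y hy using h1
    refine ⟨∑ i ∈ DFinsupp.support z, DirectSum.lof A ι T i (y i), ?_⟩
    rw [map_sum]
    simp only [DirectSum.lmap_lof, hy]
    exact DirectSum.sum_support_of z
  · rintro ⟨y, rfl⟩
    exact hz y

theorem gpf_sum {ι : Type u} (T : ι → Type u) [∀ i, AddCommGroup (T i)]
    [∀ i, Module A (T i)] (d : ∀ i, T i →ₗ[A] T i) (h : ∀ i, GPF A (T i) (d i)) :
    GPF A (DirectSum ι T) (DirectSum.lmap d) := by
  classical
  have := fun i => (h i).1
  refine ⟨inferInstance, gp_exact_lmap T d fun i => (h i).2.1, ?_⟩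
  intro I _ _ hI
  have h1 := gp_exact_lmap (fun i => T i ⊗[A] I) (fun i => (d i).rTensor I)
    (fun i => (h i).2.2 I hI)
  let E := TensorProduct.directSumLeft A A T I
  have hE : ∀ x, E ((DirectSum.lmap d).rTensor I x) =
      DirectSum.lmap (fun i => (d i).rTensor I) (E x) := by
    intro x
    have : E.toLinearMap ∘ₗ (DirectSum.lmap d).rTensor I =
        DirectSum.lmap (fun i => (d i).rTensor I) ∘ₗ E.toLinearMap := by
      ext i x y : 4
      simp [E, TensorProduct.directSumLeft_tmul_lof]
    exact LinearMap.congr_fun this x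
  intro z
  rw [← E.map_eq_zero_iff, hE, h1]
  constructor
  · rintro ⟨y, hy⟩
    exact ⟨E.symm y, E.injective (by rw [hE, E.apply_symm_apply, hy])⟩
  · rintro ⟨y, rfl⟩
    exact ⟨E y, (hE y).symm⟩
end

section
variable {A : Type u} [CommRing A]

theorem gp_exact_iso {T T' : Type u} [AddCommGroup T] [Module A T] [AddCommGroup T'] [Module A T']
    (E : T' ≃ₗ[A] T) (d : T →ₗ[A] T) (d' : T' →ₗ[A] T') (hE : ∀ x, E (d' x) = d (E x))
    (h : Function.Exact d d) : Function.Exact d' d' := by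
  intro z
  rw [← E.map_eq_zero_iff, hE, h]
  constructor
  · rintro ⟨y, hy⟩
    exact ⟨E.symm y, E.injective (by rw [hE, E.apply_symm_apply, hy])⟩
  · rintro ⟨y, rfl⟩
    exact ⟨E y, (hE y).symm⟩

theorem gpf_iso {T T' : Type u} [AddCommGroup T] [Module A T] [AddCommGroup T'] [Module A T']
    (E : T' ≃ₗ[A] T) (d : T →ₗ[A] T) (h : GPF A T d) :
    GPF A T' (E.symm.toLinearMap ∘ₗ d ∘ₗ E.toLinearMap) := by
  have := h.1
  refine ⟨Module.Flat.of_linearEquiv E, gp_exact_iso E d _ (fun x => by simp) h.2.1, ?_⟩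
  intro I _ _ hI
  refine gp_exact_iso (E.rTensor I) (d.rTensor I) _ (fun x => ?_) (h.2.2 I hI)
  have h1 : E.toLinearMap.rTensor I ∘ₗ (E.symm.toLinearMap ∘ₗ d ∘ₗ E.toLinearMap).rTensor I =
      d.rTensor I ∘ₗ E.toLinearMap.rTensor I := by
    rw [← LinearMap.rTensor_comp, ← LinearMap.rTensor_comp]
    congr 1
    ext x
    simp
  exact LinearMap.congr_fun h1 x

theorem gp_solution [IsNoetherianRing A] (hdim : ringKrullDim A < ⊤) (M : Type u) [AddCommGroup M]
    [Module A M] :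
    ∃ (T : Type u) (_ : AddCommGroup T) (_ : Module A T) (d : T →ₗ[A] T) (Φ : T →ₗ[A] M),
      GPF A T d ∧ Φ ∘ₗ d = 0 ∧
      ∀ (P : Type u) [AddCommGroup P] [Module A P] (dP : P →ₗ[A] P), GPSGP A P dP →
        ∀ φ : P →ₗ[A] M, φ ∘ₗ dP = 0 → ∃ h : P →ₗ[A] T, h ∘ₗ dP = d ∘ₗ h ∧ Φ ∘ₗ h = φ := by
  classical
  let Θ : Type u := Quotient.out (2 ^ max (2 ^ (max (Cardinal.mk (Polynomial A)) Cardinal.aleph0))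
    (Cardinal.mk M) : Cardinal.{u})
  let S := Σ K : Submodule A (Θ →₀ A), (((Θ →₀ A) ⧸ K) →ₗ[A] ((Θ →₀ A) ⧸ K)) ×
    (((Θ →₀ A) ⧸ K) →ₗ[A] M)
  let ι : Type u := {s : S // GPF A _ s.2.1 ∧ s.2.2 ∘ₗ s.2.1 = 0}
  let Tι : ι → Type u := fun s => (Θ →₀ A) ⧸ s.1.1
  let _ : ∀ s, AddCommGroup (Tι s) := fun s => Submodule.Quotient.addCommGroup s.1.1
  let _ : ∀ s, Module A (Tι s) := fun s => Submodule.Quotient.module s.1.1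
  let dι : ∀ s : ι, Tι s →ₗ[A] Tι s := fun s => s.1.2.1
  let Φι : ∀ s : ι, Tι s →ₗ[A] M := fun s => s.1.2.2
  refine ⟨DirectSum ι Tι, inferInstance, inferInstance, DirectSum.lmap dι,
    DirectSum.toModule A ι M Φι, gpf_sum Tι dι fun s => s.2.1, ?_, ?_⟩
  · refine DirectSum.linearMap_ext A fun s => LinearMap.ext fun x => ?_
    simp only [LinearMap.comp_apply, DirectSum.lmap_lof, DirectSum.toModule_lof,
      LinearMap.zero_apply]
    exact LinearMap.congr_fun s.2.2 x
  · intro P _ _ dP hP φ hφ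
    obtain ⟨H, hH, hφH, hc⟩ := gp_dpure_exists dP φ
    have hF := gpf_quot dP (hP.gpf hdim) H hH
    let φ' : (P ⧸ H) →ₗ[A] M := H.liftQ φ hφH
    obtain ⟨emb⟩ : Nonempty ((P ⧸ H) ↪ Θ) := by
      rw [← Cardinal.le_def, Cardinal.mk_out]
      exact hc
    let q : (Θ →₀ A) →ₗ[A] (P ⧸ H) := Finsupp.linearCombination A (Function.invFun emb)
    have hq : Function.Surjective q := fun x =>
      ⟨Finsupp.single (emb x) 1, by simp [q, Function.leftInverse_invFun emb.injective x]⟩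
    let E : ((Θ →₀ A) ⧸ LinearMap.ker q) ≃ₗ[A] (P ⧸ H) := q.quotKerEquivOfSurjective hq
    let dd : ((Θ →₀ A) ⧸ LinearMap.ker q) →ₗ[A] ((Θ →₀ A) ⧸ LinearMap.ker q) :=
      E.symm.toLinearMap ∘ₗ H.mapQ H dP hH.1 ∘ₗ E.toLinearMap
    have hdd : GPF A _ dd := by
      exact gpf_iso E _ hF
    let s : ι := ⟨⟨LinearMap.ker q, dd, φ' ∘ₗ E.toLinearMap⟩, hdd, by
      refine LinearMap.ext fun x => ?_
      obtain ⟨y, rfl⟩ := E.symm.surjective x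
      obtain ⟨y, rfl⟩ := H.mkQ_surjective y
      have := LinearMap.congr_fun hφ y
      change φ' (E (E.symm (H.mapQ H dP hH.1 (E (E.symm (H.mkQ y)))))) = 0
      rw [E.apply_symm_apply, E.apply_symm_apply]
      exact this⟩
    refine ⟨DirectSum.lof A ι Tι s ∘ₗ E.symm.toLinearMap ∘ₗ H.mkQ, ?_, ?_⟩
    · refine LinearMap.ext fun x => ?_
      refine Eq.trans ?_ (DirectSum.lmap_lof (R := A) dι s (E.symm (H.mkQ x))).symm
      refine congrArg (DirectSum.lof A ι Tι s) ?_
      change _ = E.symm (H.mapQ H dP hH.1 (E (E.symm (H.mkQ x))))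
      rw [E.apply_symm_apply]
      rfl
    · refine LinearMap.ext fun x => ?_
      refine (DirectSum.toModule_lof (φ := Φι) A s (E.symm (H.mkQ x))).trans ?_
      change φ' (E (E.symm (H.mkQ x))) = _
      rw [E.apply_symm_apply]
      rfl

theorem gp_sgp_of_gp {G : Type u} [AddCommGroup G] [Module A G] (hG : IsGorensteinProjective A G) :
    ∃ (P : Type u) (_ : AddCommGroup P) (_ : Module A P) (d : P →ₗ[A] P)
      (i : G →ₗ[A] LinearMap.ker d) (r : LinearMap.ker d →ₗ[A] G),
      GPSGP A P d ∧ r ∘ₗ i = LinearMap.id := by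
  classical
  obtain ⟨X, _, _, d, hX, ⟨hex, hhom⟩, n, ⟨e⟩⟩ := hG
  let P := DirectSum ℤ X
  let D : P →ₗ[A] P := DirectSum.toModule A ℤ P fun n => DirectSum.lof A ℤ X (n + 1) ∘ₗ d n
  have hDlof : ∀ n x, D (DirectSum.lof A ℤ X n x) = DirectSum.lof A ℤ X (n + 1) (d n x) := by
    intro n x
    exact DirectSum.toModule_lof ..
  have hD : ∀ n (z : P), (D z) (n + 1) = d n (z n) := by
    intro n z
    have : DirectSum.component A ℤ X (n + 1) ∘ₗ D = d n ∘ₗ DirectSum.component A ℤ X n := by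
      refine DirectSum.linearMap_ext A fun m => LinearMap.ext fun x => ?_
      simp only [LinearMap.comp_apply, hDlof]
      by_cases h : m = n
      · subst h
        rw [DirectSum.component.lof_self, DirectSum.component.lof_self]
      · have h1 : DirectSum.component A ℤ X n (DirectSum.lof A ℤ X m x) = 0 :=
          DFinsupp.single_eq_of_ne (Ne.symm h)
        have h2 : DirectSum.component A ℤ X (n + 1) (DirectSum.lof A ℤ X (m + 1) (d m x)) = 0 :=
          DFinsupp.single_eq_of_ne (by omega)
        rw [h1, h2, map_zero]
    exact LinearMap.congr_fun this z
  have hker : ∀ z : P, D z = 0 → ∀ n, d n (z n) = 0 := by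
    intro z hz n
    rw [← hD, hz]; rfl
  have hPext : ∀ z w : P, (∀ n : ℤ, z (n + 1) = w (n + 1)) → z = w := by
    intro z w h
    refine DFinsupp.ext fun m => ?_
    obtain ⟨n, rfl⟩ : ∃ n : ℤ, m = n + 1 := ⟨m - 1, by omega⟩
    exact h n
  let i0 : G →ₗ[A] LinearMap.ker D := LinearMap.codRestrict (LinearMap.ker D)
    (DirectSum.lof A ℤ X n ∘ₗ (LinearMap.ker (d n)).subtype ∘ₗ e.toLinearMap) (by
      intro x
      have : d n (e x : X n) = 0 := (e x).2
      rw [LinearMap.mem_ker]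
      change D (DirectSum.lof A ℤ X n (e x : X n)) = 0
      rw [hDlof, this, map_zero])
  let r0 : LinearMap.ker D →ₗ[A] LinearMap.ker (d n) := LinearMap.codRestrict _
    (DirectSum.component A ℤ X n ∘ₗ (LinearMap.ker D).subtype) (fun z => hker z z.2 n)
  refine ⟨P, inferInstance, inferInstance, D, i0, e.symm.toLinearMap ∘ₗ r0, ⟨?_, ?_, ?_⟩, ?_⟩
  · infer_instance
  · intro z
    constructor
    · intro hz
      have h1 : ∀ n, ∃ y, d n y = z (n + 1) := fun n => (hex n _).1 (hker z hz (n + 1))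
      choose y hy using h1
      let s : Finset ℤ := (DFinsupp.support z).image (fun m => m - 1)
      let w : P := DFinsupp.mk s (fun n => y n)
      refine ⟨w, hPext _ _ fun n => ?_⟩
      rw [hD]
      have hw : w n = if n ∈ s then y n else 0 := by
        change (DFinsupp.mk s (fun n => y n) : Π₀ i, X i) n = _
        rw [DFinsupp.mk_apply]
        split_ifs <;> rfl
      rw [hw]
      split_ifs with hn
      · exact hy n
      · rw [map_zero]
        by_contra hne
        apply hn
        simp only [s, Finset.mem_image, DFinsupp.mem_support_toFun]
        exact ⟨n + 1, fun h => hne h.symm, by omega⟩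
    · rintro ⟨y, rfl⟩
      refine DFinsupp.ext fun m => ?_
      obtain ⟨n, rfl⟩ : ∃ n : ℤ, m = n + 1 + 1 := ⟨m - 2, by omega⟩
      rw [hD, hD, (hex n).apply_apply_eq_zero]
      rfl
  · intro Q _ _ hQ f hf
    have h1 : ∀ m, ∃ g : X (m + 1) →ₗ[A] Q, g ∘ₗ d m = f ∘ₗ DirectSum.lof A ℤ X m := by
      intro m
      obtain ⟨n, rfl⟩ : ∃ n : ℤ, m = n + 1 := ⟨m - 1, by omega⟩
      refine (hhom Q hQ n _).1 (LinearMap.ext fun x => ?_)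
      change f (DirectSum.lof A ℤ X (n + 1) (d n x)) = 0
      rw [← hDlof]
      exact LinearMap.congr_fun hf _
    choose gs hgs using h1
    have h2 : ∀ k, ∃ g : X k →ₗ[A] Q, ∀ m (h : m + 1 = k) x,
        g (h ▸ d m x) = f (DirectSum.lof A ℤ X m x) := by
      intro k
      obtain ⟨n, rfl⟩ : ∃ n : ℤ, k = n + 1 := ⟨k - 1, by omega⟩
      refine ⟨gs n, ?_⟩
      intro m h x
      obtain rfl : m = n := by omega
      exact LinearMap.congr_fun (hgs m) x
    choose g hg using h2
    refine ⟨DirectSum.toModule A ℤ Q g, DirectSum.linearMap_ext A fun m => LinearMap.ext fun x => ?_⟩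
    simp only [LinearMap.comp_apply, hDlof]
    exact (DirectSum.toModule_lof ..).trans (hg (m + 1) m rfl x)
  · refine LinearMap.ext fun x => ?_
    have : r0 (i0 x) = e x := Subtype.ext (DirectSum.component.lof_self A (M := X) n (e x : X n))
    simp [this]

theorem gp_of_sgp {G Q : Type u} [AddCommGroup G] [Module A G] [AddCommGroup Q] [Module A Q]
    {i : G →ₗ[A] Q} {p : Q →ₗ[A] G} (h : GPSes i p) (hQ : GPSGP A Q (i ∘ₗ p)) :
    IsGorensteinProjective A G := by
  refine ⟨fun _ => Q, fun _ => inferInstance, fun _ => inferInstance, fun _ => i ∘ₗ p,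
    fun _ => hQ.1, ⟨fun _ => hQ.2.1, ?_⟩, 0, ?_⟩
  · intro R _ _ hR _ f
    constructor
    · intro hf
      exact hQ.2.2 R hR f hf
    · rintro ⟨g, rfl⟩
      refine LinearMap.ext fun x => ?_
      change g (i (p (i (p x)))) = 0
      rw [h.2.2.apply_apply_eq_zero, map_zero, map_zero]
  · have hr : LinearMap.range i = LinearMap.ker (i ∘ₗ p) := by
      ext x
      rw [LinearMap.mem_ker, LinearMap.comp_apply, map_eq_zero_iff i h.1, h.2.2 x]
      rfl
    exact ⟨(LinearEquiv.ofInjective i h.1).trans (LinearEquiv.ofEq _ _ hr)⟩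

theorem gp_ses_ker {P : Type u} [AddCommGroup P] [Module A P] (d : P →ₗ[A] P)
    (h : Function.Exact d d) : ∃ p : P →ₗ[A] LinearMap.ker d,
      GPSes (LinearMap.ker d).subtype p ∧ d = (LinearMap.ker d).subtype ∘ₗ p := by
  let p : P →ₗ[A] LinearMap.ker d := d.codRestrict _ h.apply_apply_eq_zero
  refine ⟨p, ⟨Submodule.injective_subtype _, ?_, ?_⟩, rfl⟩
  · rintro ⟨x, hx⟩
    obtain ⟨y, rfl⟩ := (h x).1 hx
    exact ⟨y, rfl⟩
  · intro x
    constructor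
    · intro hx
      exact ⟨⟨x, congrArg Subtype.val hx⟩, rfl⟩
    · rintro ⟨y, rfl⟩
      exact Subtype.ext y.2

end

/-- Every module over a commutative noetherian ring of finite Krull dimension admits a
Gorenstein projective precover. -/
theorem gorensteinProjective_precover
    (A : Type u) [CommRing A] [IsNoetherianRing A] (hdim : ringKrullDim A < ⊤)
    (M : Type u) [AddCommGroup M] [Module A M] :
    ∃ (G : Type u) (_ : AddCommGroup G) (_ : Module A G) (φ : G →ₗ[A] M),
      IsGorensteinProjective A G ∧
      ∀ (G' : Type u) (_ : AddCommGroup G') (_ : Module A G'),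
        IsGorensteinProjective A G' →
        ∀ ψ : G' →ₗ[A] M, ∃ h : G' →ₗ[A] G, φ ∘ₗ h = ψ := by
  obtain ⟨T, _, _, d, Φ, hT, hΦ, hsol⟩ := gp_solution hdim M
  obtain ⟨p, hs, hd⟩ := gp_ses_ker d hT.2.1
  obtain ⟨G, Q, L, _, _, _, _, _, _, iG, pG, κ, σ, hG, hQ, hκ, hL⟩ := gp_AB hdim T d hT _ _ p hs hd
  obtain ⟨Ψ, hΨ⟩ := gp_desc _ p hs.2.1 hs.2.2 Φ (by
    refine LinearMap.ext fun x => ?_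
    obtain ⟨y, hy⟩ := hs.2.1 x
    rw [← hy]
    have h1 := LinearMap.congr_fun hΦ y
    rw [hd] at h1
    exact h1)
  refine ⟨G, inferInstance, inferInstance, Ψ ∘ₗ σ, gp_of_sgp hG hQ, ?_⟩
  intro G' _ _ hG' ψ
  obtain ⟨P, _, _, dP, j, r, hP, hrj⟩ := gp_sgp_of_gp hG'
  obtain ⟨pP, hsP, hdP⟩ := gp_ses_ker dP hP.2.1
  have hpd : ∀ x, pP (dP x) = 0 := fun x => Subtype.ext (by
    have h1 : dP (dP x) = 0 := hP.2.1.apply_apply_eq_zero x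
    have h2 := LinearMap.congr_fun hdP (dP x)
    rw [h1] at h2
    exact h2.symm)
  obtain ⟨h, hh, hΦh⟩ := hsol P dP hP (ψ ∘ₗ r ∘ₗ pP) (LinearMap.ext fun x => by
    simp [hpd])
  have hh' : ∀ x, h (dP x) = d (h x) := fun x => LinearMap.congr_fun hh x
  let f : LinearMap.ker dP →ₗ[A] LinearMap.ker d := LinearMap.codRestrict _
    (h ∘ₗ (LinearMap.ker dP).subtype) (by
      intro x
      have : dP (x : P) = 0 := x.2
      change d (h (x : P)) = 0
      rw [← hh', this, map_zero])
  have hP' : GPSGP A P ((LinearMap.ker dP).subtype ∘ₗ pP) := by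
    rw [← hdP]; exact hP
  obtain ⟨g, hg⟩ := gp_orth_lift hsP hP' hκ hL f
  refine ⟨g ∘ₗ j, LinearMap.ext fun x => ?_⟩
  have hf : ∀ y, f (pP y) = p (h y) := fun y => Subtype.ext (by
    have h1 := LinearMap.congr_fun hdP y
    have h2 := LinearMap.congr_fun hd (h y)
    rw [← hh'] at h2
    change h (pP y : P) = _
    have h3 : (pP y : P) = dP y := h1.symm
    rw [h3]
    exact h2)
  have key : ∀ z, Ψ (f z) = ψ (r z) := by
    intro z
    obtain ⟨y, rfl⟩ := hsP.2.1 z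
    rw [hf]
    have h1 := LinearMap.congr_fun hΨ (h y)
    have h2 := LinearMap.congr_fun hΦh y
    exact h1.trans h2
  have h1 : σ (g (j x)) = f (j x) := LinearMap.congr_fun hg _
  have h2 : r (j x) = x := LinearMap.congr_fun hrj x
  change Ψ (σ (g (j x))) = ψ x
  rw [h1, key, h2]
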